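/- arXiv:quant-ph/9807008 — 3 statements merged into one kernel-verified Lean document; each statement's English description precedes it below -/
import Mathlib

section
/- Conditional subadditivity of mutual information: Let 𝔛₁, 𝔛₂, 𝔜₁, 𝔜₂ be pairwise compatible unital *-subalgebras of M_n(ℂ) and ρ a state on M_n(ℂ). If I_ρ(𝔜₁∧𝔛₂𝔜₂|𝔛₁) = 0 and I_ρ(𝔜₂∧𝔛₁𝔜₁|𝔛₂) = 0, then I_ρ(𝔛₁𝔛₂∧𝔜₁𝔜₂) ≤ I_ρ(𝔛₁∧𝔜₁) + I_ρ(𝔛₂∧𝔜₂). -/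
open scoped ComplexOrder Kronecker
open Matrix

noncomputable def negMulLogb (x : ℝ) : ℝ := -(x * Real.logb 2 x)

noncomputable def shannonEntropy {α : Type*} [Fintype α] (p : α → ℝ) : ℝ :=
  ∑ i, negMulLogb (p i)

noncomputable def mutualInfo {α β : Type*} [Fintype α] [Fintype β]
    (p : α → β → ℝ) : ℝ :=
  shannonEntropy (fun i => ∑ j, p i j) + shannonEntropy (fun j => ∑ i, p i j)
    - shannonEntropy (fun ij : α × β => p ij.1 ij.2)

noncomputable def binEnt (t : ℝ) : ℝ := negMulLogb t + negMulLogb (1 - t)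

noncomputable def vnEntropy {α : Type*} [Fintype α] [DecidableEq α]
    (ρ : Matrix α α ℂ) : ℝ :=
  if h : ρ.IsHermitian then ∑ i, negMulLogb (h.eigenvalues i) else 0

noncomputable def matLogb {α : Type*} [Fintype α] [DecidableEq α]
    (A : Matrix α α ℂ) : Matrix α α ℂ :=
  if h : A.IsHermitian then
    (h.eigenvectorUnitary : Matrix α α ℂ) *
      Matrix.diagonal (fun i => (Real.logb 2 (h.eigenvalues i) : ℂ)) *
      star (h.eigenvectorUnitary : Matrix α α ℂ)
  else 0

def MatState {α : Type*} [Fintype α] [DecidableEq α] (ρ : Matrix α α ℂ) : Prop :=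
  ρ.PosSemidef ∧ ρ.trace = 1

def IsProjn {α : Type*} [Fintype α] [DecidableEq α] (p : Matrix α α ℂ) : Prop :=
  p.IsHermitian ∧ p * p = p

def IsMinProjOf {α : Type*} [Fintype α] [DecidableEq α]
    (X : StarSubalgebra ℂ (Matrix α α ℂ)) (p : Matrix α α ℂ) : Prop :=
  p ∈ X ∧ IsProjn p ∧ p ≠ 0 ∧
    ∀ q ∈ X, IsProjn q → q * p = q → q = 0 ∨ q = p

def IsCanonicalTrace {α : Type*} [Fintype α] [DecidableEq α]
    (X : StarSubalgebra ℂ (Matrix α α ℂ)) (τ : Matrix α α ℂ →ₗ[ℂ] ℂ) : Prop :=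
  (∀ x ∈ X, ∀ y ∈ X, τ (x * y) = τ (y * x)) ∧
  (∀ x ∈ X, 0 ≤ τ (star x * x)) ∧
  (∀ p, IsMinProjOf X p → τ p = 1)

def IsRestriction {α : Type*} [Fintype α] [DecidableEq α]
    (X : StarSubalgebra ℂ (Matrix α α ℂ)) (τ : Matrix α α ℂ →ₗ[ℂ] ℂ)
    (ρ r : Matrix α α ℂ) : Prop :=
  r ∈ X ∧ r.PosSemidef ∧ ∀ x ∈ X, τ (r * x) = (ρ * x).trace

noncomputable def algEntropy {α : Type*} [Fintype α] [DecidableEq α]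
    (τ : Matrix α α ℂ →ₗ[ℂ] ℂ) (r : Matrix α α ℂ) : ℝ :=
  -(τ (r * matLogb r)).re

def IsAlgEntropy {α : Type*} [Fintype α] [DecidableEq α]
    (X : StarSubalgebra ℂ (Matrix α α ℂ)) (ρ : Matrix α α ℂ) (H : ℝ) : Prop :=
  ∃ τ r, IsCanonicalTrace X τ ∧ IsRestriction X τ ρ r ∧ H = algEntropy τ r

def CompatibleAlg {α : Type*} [Fintype α] [DecidableEq α]
    (X Y : StarSubalgebra ℂ (Matrix α α ℂ)) : Prop :=
  ∀ x ∈ X, ∀ y ∈ Y, x * y = y * x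

section AlgebraicEntropy

variable {α : Type*} [Fintype α] [DecidableEq α]

theorem Matrix.IsHermitian.exists_spectral_projections (M : StarSubalgebra ℂ (Matrix α α ℂ))
    {h : Matrix α α ℂ} (hM : h ∈ M) (hh : h.IsHermitian) :
    ∃ (S : Finset ℝ) (P : ℝ → Matrix α α ℂ), (∀ l ∈ S, P l ∈ M ∧ IsProjn (P l) ∧
      h * P l = (l : ℂ) • P l ∧ matLogb h * P l = ((Real.logb 2 l : ℝ) : ℂ) • P l) ∧
      ∑ l ∈ S, P l = 1 := by
  set U := hh.eigenvectorUnitary with hU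
  set Φ := Unitary.conjStarAlgAut ℂ (Matrix α α ℂ) U with hΦ
  have hsp : h = Φ (diagonal (fun i => (hh.eigenvalues i : ℂ))) := hh.spectral_theorem
  have hlog : matLogb h = Φ (diagonal (fun i => (Real.logb 2 (hh.eigenvalues i) : ℂ))) := by
    simp [matLogb, hh, hΦ, Unitary.conjStarAlgAut_apply, hU]
  let D : ℝ → Matrix α α ℂ := fun l => diagonal (fun i => if hh.eigenvalues i = l then 1 else 0)
  refine ⟨Finset.univ.image hh.eigenvalues, fun l => Φ (D l), ?_, ?_⟩
  · intro l hl
    refine ⟨?_, ⟨?_, ?_⟩, ?_, ?_⟩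
    · let T : Finset ℂ := Finset.univ.image (fun i => (hh.eigenvalues i : ℂ))
      let p : Polynomial ℂ := Lagrange.interpolate T id (fun z => if z = (l : ℂ) then 1 else 0)
      have hp : ∀ i, p.eval (hh.eigenvalues i : ℂ) = if hh.eigenvalues i = l then 1 else 0 := by
        intro i
        have := Lagrange.eval_interpolate_at_node (s := T) (v := id)
          (fun z => if z = (l : ℂ) then (1 : ℂ) else 0) Function.injective_id.injOn
          (i := (hh.eigenvalues i : ℂ)) (by simp [T])
        simpa [p] using this
      have : Φ (D l) = Polynomial.aeval h p := by
        have h1 := Polynomial.aeval_algHom_apply (AlgHomClass.toAlgHom Φ)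
          (diagonal (fun i => (hh.eigenvalues i : ℂ))) p
        have h2 := Polynomial.aeval_algHom_apply (diagonalAlgHom (n := α) (α := ℂ) ℂ)
          (fun i => (hh.eigenvalues i : ℂ)) p
        have h3 : Polynomial.aeval (fun i => (hh.eigenvalues i : ℂ)) p =
            fun i => if hh.eigenvalues i = l then 1 else 0 := by
          ext i
          rw [← hp i, ← Polynomial.coe_aeval_eq_eval]
          exact (Polynomial.aeval_algHom_apply (Pi.evalAlgHom ℂ (fun _ : α => ℂ) i) _ p).symm
        rw [h3] at h2
        simp only [diagonalAlgHom_apply] at h2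
        simp only [AlgHom.coe_coe] at h1
        rw [h2, ← hsp] at h1
        exact h1.symm
      change Φ (D l) ∈ M
      rw [this]
      exact (Algebra.adjoin_le (S := M.toSubalgebra) (Set.singleton_subset_iff.2 hM) :)
        (Polynomial.aeval_mem_adjoin_singleton ℂ h)
    · rw [IsHermitian, ← star_eq_conjTranspose, ← map_star]
      congr 1
      simp only [D, star_eq_conjTranspose, diagonal_conjTranspose]
      congr 1; ext i; simp only [Pi.star_apply]; split_ifs <;> simp
    · rw [← map_mul]
      simp [D]
    · conv_lhs => rw [hsp]
      rw [← map_mul, ← map_smul]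
      congr 1
      simp only [D, diagonal_mul_diagonal, ← diagonal_smul]
      congr 1; ext i; simp only [Pi.smul_apply]; split_ifs with hi <;> simp [hi]
    · rw [hlog, ← map_mul, ← map_smul]
      congr 1
      simp only [D, diagonal_mul_diagonal, ← diagonal_smul]
      congr 1; ext i; simp only [Pi.smul_apply]; split_ifs with hi <;> simp [hi]
  · rw [← map_sum, ← map_one Φ]
    congr 1
    ext i j
    by_cases hij : i = j
    · subst hij
      simp [D, Matrix.sum_apply]
    · simp [D, Matrix.sum_apply, hij]

theorem IsProjn.star_eq {p : Matrix α α ℂ} (hp : IsProjn p) : star p = p := hp.1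

theorem IsProjn.mul_comm_of_le {p q : Matrix α α ℂ} (hp : IsProjn p) (hq : IsProjn q)
    (h : p * q = p) : q * p = p := by
  have := congrArg star h
  rwa [star_mul, hp.star_eq, hq.star_eq] at this

theorem IsProjn.posSemidef {p : Matrix α α ℂ} (hp : IsProjn p) : p.PosSemidef := by
  have := posSemidef_conjTranspose_mul_self p
  rwa [hp.1.eq, hp.2] at this

theorem IsMinProjOf.exists_compress_hermitian {M : StarSubalgebra ℂ (Matrix α α ℂ)}
    {p : Matrix α α ℂ} (hp : IsMinProjOf M p) {x : Matrix α α ℂ} (hx : x ∈ M)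
    (hxh : x.IsHermitian) : ∃ c : ℂ, p * x * p = c • p := by
  obtain ⟨hpM, hpp, -, hmin⟩ := hp
  have hyM : p * x * p ∈ M := mul_mem (mul_mem hpM hx) hpM
  have hyh : (p * x * p).IsHermitian := by
    rw [IsHermitian, conjTranspose_mul, conjTranspose_mul, hpp.1.eq, hxh.eq, mul_assoc]
  obtain ⟨S, P, hP, hsum⟩ := IsHermitian.exists_spectral_projections M hyM hyh
  have key : ∀ l ∈ S, ∃ c : ℂ, p * x * p * P l = c • p := by
    intro l hl
    obtain ⟨hPM, hPp, hPe, -⟩ := hP l hl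
    by_cases hl0 : l = 0
    · exact ⟨0, by rw [hPe, hl0]; simp⟩
    have h1 : p * P l = P l := by
      have h2 : P l = (l : ℂ)⁻¹ • (p * x * p * P l) := by
        rw [hPe, smul_smul, inv_mul_cancel₀ (by exact_mod_cast hl0), one_smul]
      rw [h2, mul_smul_comm]
      congr 1
      simp only [← mul_assoc, hpp.2]
    rcases hmin (P l) hPM hPp (by
      have := congrArg star h1
      rwa [star_mul, hpp.star_eq, hPp.star_eq] at this) with h | h
    · exact ⟨0, by rw [h]; simp⟩
    · exact ⟨l, by rw [hPe, h]⟩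
  choose! c hc using key
  refine ⟨∑ l ∈ S, c l, ?_⟩
  calc p * x * p = p * x * p * ∑ l ∈ S, P l := by rw [hsum, mul_one]
    _ = ∑ l ∈ S, c l • p := by rw [Finset.mul_sum]; exact Finset.sum_congr rfl hc
    _ = _ := by rw [Finset.sum_smul]

theorem IsMinProjOf.exists_compress {M : StarSubalgebra ℂ (Matrix α α ℂ)}
    {p : Matrix α α ℂ} (hp : IsMinProjOf M p) {x : Matrix α α ℂ} (hx : x ∈ M) :
    ∃ c : ℂ, p * x * p = c • p := by
  have hsx : star x ∈ M := star_mem hx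
  obtain ⟨a, ha⟩ := hp.exists_compress_hermitian (x := x + star x) (add_mem hx hsx)
    (by rw [IsHermitian, ← star_eq_conjTranspose, star_add, star_star, add_comm])
  obtain ⟨b, hb⟩ := hp.exists_compress_hermitian (x := Complex.I • (x - star x))
    (SMulMemClass.smul_mem _ (sub_mem hx hsx)) (by
      rw [IsHermitian, ← star_eq_conjTranspose, star_smul, star_sub, star_star]
      simp [sub_eq_add_neg, add_comm])
  refine ⟨(1 / 2) * a + (-Complex.I / 2) * b, ?_⟩
  have hxe : x = (1 / 2 : ℂ) • (x + star x) +
      (-Complex.I / 2) • (Complex.I • (x - star x)) := by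
    rw [smul_smul, show -Complex.I / 2 * Complex.I = (1 / 2 : ℂ) by
      rw [div_mul_eq_mul_div, neg_mul, Complex.I_mul_I, neg_neg]]
    rw [← smul_add, add_add_sub_cancel, ← two_smul ℂ x, smul_smul]; norm_num
  conv_lhs => rw [hxe]
  rw [mul_add, add_mul, mul_smul_comm, smul_mul_assoc, ha, mul_smul_comm, smul_mul_assoc, hb,
    add_smul, smul_smul, smul_smul]

theorem IsProjn.exists_minProj_decomposition (M : StarSubalgebra ℂ (Matrix α α ℂ))
    (e : Matrix α α ℂ) (heM : e ∈ M) (he : IsProjn e) :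
    ∃ (ι : Type) (_ : Fintype ι) (P : ι → Matrix α α ℂ),
      (∀ i, IsMinProjOf M (P i) ∧ P i * e = P i) ∧ ∑ i, P i = e := by
  let S : Matrix α α ℂ → Submodule ℂ (Matrix α α ℂ) := fun e =>
    LinearMap.eqLocus (LinearMap.mulLeft ℂ e) LinearMap.id
  have hS : ∀ e x, x ∈ S e ↔ e * x = x := fun e x => by simp [S, LinearMap.mem_eqLocus]
  induction hV : S e using WellFoundedLT.induction generalizing e with
  | ind V ih =>
    subst hV
    by_cases h0 : e = 0
    · exact ⟨Empty, inferInstance, Empty.elim, fun i => i.elim, by simp [h0]⟩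
    by_cases hm : IsMinProjOf M e
    · exact ⟨Unit, inferInstance, fun _ => e, fun _ => ⟨hm, he.2⟩, by simp⟩
    have : ∃ q ∈ M, IsProjn q ∧ q * e = q ∧ q ≠ 0 ∧ q ≠ e := by
      by_contra! hcon
      exact hm ⟨heM, he, h0, fun q hqM hq hqe => or_iff_not_imp_left.2 fun hq0 =>
        hcon q hqM hq hqe hq0⟩
    obtain ⟨q, hqM, hq, hqe, hq0, hqne⟩ := this
    have heq : e * q = q := hq.mul_comm_of_le he hqe
    have hlt : ∀ q : Matrix α α ℂ, e * q = q → q * e = q → q ≠ e → S q < S e := by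
      intro q heq hqe hne
      refine lt_of_le_of_ne (fun x hx => ?_) (fun hSe => hne ?_)
      · rw [hS] at hx ⊢
        rw [← hx, ← mul_assoc, heq]
      · have : e ∈ S q := by rw [hSe, hS]; exact he.2
        rw [hS, hqe] at this
        exact this
    have hq' : IsProjn (e - q) := by
      refine ⟨he.1.sub hq.1, ?_⟩
      rw [sub_mul, mul_sub, mul_sub, he.2, hq.2, heq, hqe]; simp
    obtain ⟨ι₁, _, P₁, hP₁, hs₁⟩ := ih _ (hlt q heq hqe hqne) q hqM hq rfl
    obtain ⟨ι₂, _, P₂, hP₂, hs₂⟩ := ih _ (hlt (e - q) (by rw [mul_sub, he.2, heq])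
      (by rw [sub_mul, he.2, hqe]) (by simpa using hq0)) (e - q) (sub_mem heM hqM) hq' rfl
    refine ⟨ι₁ ⊕ ι₂, inferInstance, Sum.elim P₁ P₂, ?_, ?_⟩
    · rintro (i | i)
      · refine ⟨(hP₁ i).1, ?_⟩
        simp only [Sum.elim_inl]
        rw [← (hP₁ i).2, mul_assoc, hqe]
      · refine ⟨(hP₂ i).1, ?_⟩
        simp only [Sum.elim_inr]
        rw [← (hP₂ i).2, mul_assoc, sub_mul, he.2, hqe]
    · simp [hs₁, hs₂]

/-- Diagonalization of a Hermitian element by minimal projections of the algebra. -/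
theorem Matrix.IsHermitian.exists_minProj_diagonalization (M : StarSubalgebra ℂ (Matrix α α ℂ))
    {h : Matrix α α ℂ} (hM : h ∈ M) (hh : h.IsHermitian) :
    ∃ (ι : Type) (_ : Fintype ι) (P : ι → Matrix α α ℂ) (l : ι → ℝ),
      (∀ i, IsMinProjOf M (P i)) ∧ ∑ i, P i = 1 ∧ (∀ i, h * P i = (l i : ℂ) • P i) ∧
      ∀ i, matLogb h * P i = ((Real.logb 2 (l i) : ℝ) : ℂ) • P i := by
  obtain ⟨S, P, hP, hsum⟩ := IsHermitian.exists_spectral_projections M hM hh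
  have key : ∀ l : S, ∃ (ι : Type) (_ : Fintype ι) (Q : ι → Matrix α α ℂ),
      (∀ i, IsMinProjOf M (Q i) ∧ Q i * P l = Q i) ∧ ∑ i, Q i = P l := fun l =>
    (hP l l.2).2.1.exists_minProj_decomposition M _ (hP l l.2).1
  choose ι hι Q hQ hQs using key
  have hle : ∀ x : Σ l : S, ι l, P x.1 * Q x.1 x.2 = Q x.1 x.2 := fun x =>
    (hQ x.1 x.2).1.2.1.mul_comm_of_le (hP x.1 x.1.2).2.1 (hQ x.1 x.2).2
  refine ⟨Σ l : S, ι l, inferInstance, fun x => Q x.1 x.2, fun x => x.1, fun x =>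
    (hQ x.1 x.2).1, ?_, fun x => ?_, fun x => ?_⟩
  · rw [Fintype.sum_sigma]
    simp only [hQs]
    rw [← hsum, Finset.sum_coe_sort S P]
  · dsimp only
    rw [← hle x, ← mul_assoc, (hP x.1 x.1.2).2.2.1, smul_mul_assoc]
  · dsimp only
    rw [← hle x, ← mul_assoc, (hP x.1 x.1.2).2.2.2, smul_mul_assoc]

theorem CompatibleAlg.mem_span_of_mem_sup {M N : StarSubalgebra ℂ (Matrix α α ℂ)}
    (hMN : CompatibleAlg M N) {x : Matrix α α ℂ} (hx : x ∈ M ⊔ N) :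
    x ∈ Submodule.span ℂ {w | ∃ z ∈ M, ∃ y ∈ N, w = z * y} := by
  have hle : M ⊔ N ≤ StarAlgebra.adjoin ℂ ((M : Set (Matrix α α ℂ)) ∪ N) :=
    sup_le (fun y hy => StarAlgebra.subset_adjoin ℂ _ (Or.inl hy))
      (fun y hy => StarAlgebra.subset_adjoin ℂ _ (Or.inr hy))
  have hx' := hle hx
  clear hx
  induction hx' using StarAlgebra.adjoin_induction with
  | mem x hx =>
    rcases hx with hx | hx
    · exact Submodule.subset_span ⟨x, hx, 1, one_mem _, (mul_one x).symm⟩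
    · exact Submodule.subset_span ⟨1, one_mem _, x, hx, (one_mul x).symm⟩
  | algebraMap r =>
    exact Submodule.subset_span ⟨_, algebraMap_mem M r, 1, one_mem _, (mul_one _).symm⟩
  | add x y _ _ hx hy => exact add_mem hx hy
  | mul x y hx' hy' hx hy =>
    clear hx' hy'
    induction hx using Submodule.span_induction with
    | zero => simp
    | add a b _ _ ha hb => rw [add_mul]; exact add_mem ha hb
    | smul c a _ ha => rw [smul_mul_assoc]; exact Submodule.smul_mem _ _ ha
    | mem a ha =>
      obtain ⟨z, hz, w, hw, rfl⟩ := ha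
      induction hy using Submodule.span_induction with
      | zero => simp
      | add a b _ _ ha hb => rw [mul_add]; exact add_mem ha hb
      | smul c a _ ha => rw [mul_smul_comm]; exact Submodule.smul_mem _ _ ha
      | mem a ha =>
        obtain ⟨z', hz', w', hw', rfl⟩ := ha
        refine Submodule.subset_span ⟨z * z', mul_mem hz hz', w * w', mul_mem hw hw', ?_⟩
        rw [mul_assoc, ← mul_assoc w, ← hMN z' hz' w hw]
        simp only [mul_assoc]
  | star x hx' hx =>
    clear hx'
    induction hx using Submodule.span_induction with
    | zero => simp
    | add a b _ _ ha hb => rw [star_add]; exact add_mem ha hb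
    | smul c a _ ha => rw [star_smul]; exact Submodule.smul_mem _ _ ha
    | mem a ha =>
      obtain ⟨z, hz, w, hw, rfl⟩ := ha
      refine Submodule.subset_span ⟨star z, star_mem hz, star w, star_mem hw, ?_⟩
      rw [star_mul, hMN _ (star_mem hz) _ (star_mem hw)]

theorem CompatibleAlg.sup_left {M N K : StarSubalgebra ℂ (Matrix α α ℂ)}
    (hMN : CompatibleAlg M N) (hMK : CompatibleAlg M K) (hNK : CompatibleAlg N K) :
    CompatibleAlg (M ⊔ N) K := by
  intro x hx k hk
  have := hMN.mem_span_of_mem_sup hx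
  clear hx
  induction this using Submodule.span_induction with
  | zero => simp
  | add a b _ _ ha hb => rw [add_mul, mul_add, ha, hb]
  | smul c a _ ha => rw [smul_mul_assoc, mul_smul_comm, ha]
  | mem a ha =>
    obtain ⟨z, hz, w, hw, rfl⟩ := ha
    rw [mul_assoc, hNK w hw k hk, ← mul_assoc, hMK z hz k hk, mul_assoc]

theorem IsMinProjOf.exists_compress_sup {M N : StarSubalgebra ℂ (Matrix α α ℂ)}
    (hMN : CompatibleAlg M N) {q : Matrix α α ℂ} (hq : IsMinProjOf N q)
    {x : Matrix α α ℂ} (hx : x ∈ M ⊔ N) : ∃ u ∈ M, q * x * q = u * q := by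
  have := hMN.mem_span_of_mem_sup hx
  clear hx
  induction this using Submodule.span_induction with
  | zero => exact ⟨0, zero_mem _, by simp⟩
  | add a b _ _ ha hb =>
    obtain ⟨u, hu, hu'⟩ := ha
    obtain ⟨v, hv, hv'⟩ := hb
    exact ⟨u + v, add_mem hu hv, by rw [mul_add, add_mul, hu', hv', add_mul]⟩
  | smul c a _ ha =>
    obtain ⟨u, hu, hu'⟩ := ha
    exact ⟨c • u, SMulMemClass.smul_mem _ hu, by
      rw [mul_smul_comm, smul_mul_assoc, hu', smul_mul_assoc]⟩
  | mem a ha =>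
    obtain ⟨z, hz, y, hy, rfl⟩ := ha
    obtain ⟨c, hc⟩ := hq.exists_compress hy
    refine ⟨c • z, SMulMemClass.smul_mem _ hz, ?_⟩
    rw [← mul_assoc, ← hMN z hz q hq.1, mul_assoc, mul_assoc, ← mul_assoc q, hc, mul_smul_comm,
      smul_mul_assoc]

theorem IsProjn.mul {p q : Matrix α α ℂ} (hp : IsProjn p) (hq : IsProjn q)
    (h : p * q = q * p) : IsProjn (p * q) := by
  refine ⟨?_, ?_⟩
  · rw [IsHermitian, conjTranspose_mul, hp.1.eq, hq.1.eq, h]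
  · rw [mul_assoc, ← mul_assoc q, ← h, mul_assoc, hq.2, ← mul_assoc, hp.2]

theorem IsMinProjOf.mul {M N : StarSubalgebra ℂ (Matrix α α ℂ)} (hMN : CompatibleAlg M N)
    {p q : Matrix α α ℂ} (hp : IsMinProjOf M p) (hq : IsMinProjOf N q) (h0 : p * q ≠ 0) :
    IsMinProjOf (M ⊔ N) (p * q) := by
  have hc : p * q = q * p := hMN p hp.1 q hq.1
  have hpq : IsProjn (p * q) := hp.2.1.mul hq.2.1 hc
  refine ⟨mul_mem (StarSubalgebra.mem_sup_left hp.1) (StarSubalgebra.mem_sup_right hq.1),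
    hpq, h0, fun e he hep hle => ?_⟩
  have hle' := hep.mul_comm_of_le hpq hle
  obtain ⟨u, hu, hu'⟩ := hq.exists_compress_sup hMN he
  obtain ⟨c, hc'⟩ := hp.exists_compress hu
  have hec : e = c • (p * q) := by
    calc e = p * q * e * (q * p) := by rw [hle', ← hc, hle]
      _ = p * (q * e * q) * p := by simp only [mul_assoc]
      _ = p * u * (q * p) := by rw [hu']; simp only [mul_assoc]
      _ = p * u * p * q := by rw [← hc]; simp only [mul_assoc]
      _ = _ := by rw [hc', smul_mul_assoc]
  have hcc : (c * c - c) • (p * q) = 0 := by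
    have := hep.2
    rw [hec, smul_mul_smul_comm, hpq.2] at this
    rw [sub_smul, this, sub_self]
  rcases smul_eq_zero.1 hcc with h | h
  · have : c * (c - 1) = 0 := by rw [← h]; ring
    rcases mul_eq_zero.1 this with h | h
    · left; rw [hec, h, zero_smul]
    · right; rw [hec, sub_eq_zero.1 h, one_smul]
  · exact absurd h h0

theorem IsProjn.nonneg_of_smul_posSemidef {p : Matrix α α ℂ} (hp : IsProjn p) (h0 : p ≠ 0)
    {l : ℝ} (h : ((l : ℂ) • p).PosSemidef) : 0 ≤ l := by
  have h1 := hp.posSemidef.trace_nonneg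
  have h2 : p.trace ≠ 0 := fun h => h0 (hp.posSemidef.trace_eq_zero_iff.1 h)
  have h3 := h.trace_nonneg
  rw [trace_smul, smul_eq_mul] at h3
  have h4 : 0 < p.trace := lt_of_le_of_ne h1 h2.symm
  rw [Complex.le_def] at h3
  rw [Complex.lt_def] at h4
  simp only [Complex.zero_re, Complex.mul_re, Complex.ofReal_re, Complex.ofReal_im] at h3 h4
  nlinarith [h3.1, h4.1]

/-- A positive element of the algebra is a nonnegative combination of minimal projections. -/
theorem Matrix.PosSemidef.exists_minProj_diagonalization (M : StarSubalgebra ℂ (Matrix α α ℂ))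
    {h : Matrix α α ℂ} (hM : h ∈ M) (hh : h.PosSemidef) :
    ∃ (ι : Type) (_ : Fintype ι) (P : ι → Matrix α α ℂ) (l : ι → ℝ),
      (∀ i, IsMinProjOf M (P i)) ∧ ∑ i, P i = 1 ∧ (∀ i, 0 ≤ l i) ∧
      (∀ i, h * P i = (l i : ℂ) • P i) ∧
      h = ∑ i, (l i : ℂ) • P i ∧ matLogb h = ∑ i, ((Real.logb 2 (l i) : ℝ) : ℂ) • P i := by
  obtain ⟨ι, _, P, l, hP, hs, he, hlog⟩ := hh.1.exists_minProj_diagonalization M hM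
  refine ⟨ι, inferInstance, P, l, hP, hs, fun i => ?_, he, ?_, ?_⟩
  · refine (hP i).2.1.nonneg_of_smul_posSemidef (hP i).2.2.1 ?_
    have := hh.mul_mul_conjTranspose_same (P i)
    rwa [(hP i).2.1.1.eq, mul_assoc, he, mul_smul_comm, (hP i).2.1.2] at this
  · rw [← Finset.sum_congr rfl (fun i _ => he i), ← Finset.mul_sum, hs, mul_one]
  · rw [← Finset.sum_congr rfl (fun i _ => hlog i), ← Finset.mul_sum, hs, mul_one]

section Comparison

variable {Z Y₁ Y₂ : StarSubalgebra ℂ (Matrix α α ℂ)} {τA τB τC τZ : Matrix α α ℂ →ₗ[ℂ] ℂ}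

theorem IsCanonicalTrace.mul_minProj_le {B Y : StarSubalgebra ℂ (Matrix α α ℂ)}
    (hBY : CompatibleAlg B Y) (hA : IsCanonicalTrace (B ⊔ Y) τA) (hB : IsCanonicalTrace B τB)
    {w q : Matrix α α ℂ} (hw : w ∈ B) (hwp : w.PosSemidef) (hq : IsMinProjOf Y q) :
    (τA (w * q)).re ≤ (τB w).re := by
  obtain ⟨ι, _, P, l, hP, -, hl, -, hwe, -⟩ := hwp.exists_minProj_diagonalization B hw
  rw [hwe, Finset.sum_mul, map_sum, map_sum, Complex.re_sum, Complex.re_sum]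
  refine Finset.sum_le_sum fun i _ => ?_
  rw [smul_mul_assoc, map_smul, map_smul, hB.2.2 _ (hP i)]
  by_cases h0 : P i * q = 0
  · rw [h0]; simpa using hl i
  · rw [hA.2.2 _ ((hP i).mul hBY hq h0)]

theorem IsRestriction.compare_of_compress (hZ1 : CompatibleAlg Z Y₁) (hZ2 : CompatibleAlg Z Y₂)
    (h12 : CompatibleAlg Y₁ Y₂) (hA : IsCanonicalTrace (Z ⊔ Y₁ ⊔ Y₂) τA)
    (hB : IsCanonicalTrace (Z ⊔ Y₁) τB) (hC : IsCanonicalTrace (Z ⊔ Y₂) τC)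
    (hZ : IsCanonicalTrace Z τZ) {ρ rB rZ : Matrix α α ℂ}
    (hrB : IsRestriction (Z ⊔ Y₁) τB ρ rB) (hrZ : IsRestriction Z τZ ρ rZ)
    {u q : Matrix α α ℂ} (hu : u ∈ Z) (huh : u.IsHermitian) (hq : IsMinProjOf Y₂ q)
    (huq : (u * q).PosSemidef) :
    (τA (rB * (u * q))).re ≤ (τC (rZ * (u * q))).re := by
  obtain ⟨ι, _, P, l, hP, hs, he, -⟩ := huh.exists_minProj_diagonalization Z hu
  have hue : u = ∑ i, (l i : ℂ) • P i := by
    rw [← Finset.sum_congr rfl (fun i _ => he i), ← Finset.mul_sum, hs, mul_one]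
  have hBq : CompatibleAlg (Z ⊔ Y₁) Y₂ := hZ1.sup_left hZ2 h12
  rw [hue, Finset.sum_mul, Finset.mul_sum, Finset.mul_sum, map_sum, map_sum, Complex.re_sum,
    Complex.re_sum]
  refine Finset.sum_le_sum fun i _ => ?_
  have hPi := hP i
  set p := P i with hp
  simp only [smul_mul_assoc, mul_smul_comm, map_smul, smul_eq_mul, Complex.re_ofReal_mul]
  by_cases h0 : p * q = 0
  · simp [h0]
  have hpq : p * q = q * p := hZ2 p hPi.1 q hq.1
  have hpqp : p * (p * q) = p * q := by rw [← mul_assoc, hPi.2.1.2]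
  have hqpp : p * q * p = p * q := by rw [mul_assoc, ← hpq, hpqp]
  have hl : 0 ≤ l i := by
    refine (hPi.2.1.mul hq.2.1 hpq).nonneg_of_smul_posSemidef h0 ?_
    have := huq.mul_mul_conjTranspose_same p
    rwa [hPi.2.1.1.eq, mul_assoc, mul_assoc, ← hpq, ← mul_assoc u, he, ← hp, smul_mul_assoc,
      mul_smul_comm, hpqp] at this
  have hpB : p ∈ Z ⊔ Y₁ := StarSubalgebra.mem_sup_left hPi.1
  have hpA : p ∈ Z ⊔ Y₁ ⊔ Y₂ := StarSubalgebra.mem_sup_left hpB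
  have hpC : p ∈ Z ⊔ Y₂ := StarSubalgebra.mem_sup_left hPi.1
  have hqA : q ∈ Z ⊔ Y₁ ⊔ Y₂ := StarSubalgebra.mem_sup_right hq.1
  have hqC : q ∈ Z ⊔ Y₂ := StarSubalgebra.mem_sup_right hq.1
  refine mul_le_mul_of_nonneg_left ?_ hl
  have hleft : τA (rB * (p * q)) = τA (p * rB * p * q) := by
    rw [← hqpp, ← mul_assoc,
      hA.1 _ (mul_mem (StarSubalgebra.mem_sup_left hrB.1) (mul_mem hpA hqA)) _ hpA]
    simp only [mul_assoc]
  have hright : τC (rZ * (p * q)) = τC (p * rZ * p * q) := by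
    rw [← hqpp, ← mul_assoc,
      hC.1 _ (mul_mem (StarSubalgebra.mem_sup_left hrZ.1) (mul_mem hpC hqC)) _ hpC]
    simp only [mul_assoc]
  have hBp : τB (p * rB * p) = (ρ * p).trace := by
    rw [mul_assoc, hB.1 _ hpB _ (mul_mem hrB.1 hpB), mul_assoc, hPi.2.1.2, hrB.2.2 _ hpB]
  have hZp : τZ (p * rZ * p) = (ρ * p).trace := by
    rw [mul_assoc, hZ.1 _ hPi.1 _ (mul_mem hrZ.1 hPi.1), mul_assoc, hPi.2.1.2,
      hrZ.2.2 _ hPi.1]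
  obtain ⟨c, hc⟩ := hPi.exists_compress hrZ.1
  rw [hc, map_smul, hZ.2.2 _ hPi] at hZp
  rw [hleft, hright, hc, smul_mul_assoc, map_smul, hC.2.2 _ (hPi.mul hZ2 hq h0), hZp, ← hBp]
  refine hA.mul_minProj_le hBq hB (mul_mem (mul_mem hpB hrB.1) hpB) ?_ hq
  have := hrB.2.1.mul_mul_conjTranspose_same p
  rwa [hPi.2.1.1.eq] at this

theorem IsRestriction.compare (hZ1 : CompatibleAlg Z Y₁) (hZ2 : CompatibleAlg Z Y₂)
    (h12 : CompatibleAlg Y₁ Y₂) (hA : IsCanonicalTrace (Z ⊔ Y₁ ⊔ Y₂) τA)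
    (hB : IsCanonicalTrace (Z ⊔ Y₁) τB) (hC : IsCanonicalTrace (Z ⊔ Y₂) τC)
    (hZ : IsCanonicalTrace Z τZ) {ρ rB rZ : Matrix α α ℂ}
    (hrB : IsRestriction (Z ⊔ Y₁) τB ρ rB) (hrZ : IsRestriction Z τZ ρ rZ)
    {x : Matrix α α ℂ} (hx : x ∈ Z ⊔ Y₂) :
    (τA (rB * (x * star x))).re ≤ (τC (rZ * (x * star x))).re := by
  have hBq : CompatibleAlg (Z ⊔ Y₁) Y₂ := hZ1.sup_left hZ2 h12
  have hCA : Z ⊔ Y₂ ≤ Z ⊔ Y₁ ⊔ Y₂ := sup_le_sup_right le_sup_left _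
  set b := x * star x with hb
  have hbC : b ∈ Z ⊔ Y₂ := mul_mem hx (star_mem hx)
  have hbp : b.PosSemidef := posSemidef_self_mul_conjTranspose x
  obtain ⟨ι, _, q, -, hq, hs, -, -⟩ :=
    (isHermitian_one (α := ℂ) (n := α)).exists_minProj_diagonalization Y₂ (one_mem _)
  have expand : ∀ (D : StarSubalgebra ℂ (Matrix α α ℂ)) (τ : Matrix α α ℂ →ₗ[ℂ] ℂ)
      (a : Matrix α α ℂ), IsCanonicalTrace D τ → a ∈ D → b ∈ D → (∀ i, q i ∈ D) →
      (∀ i, a * q i = q i * a) → τ (a * b) = ∑ i, τ (a * (q i * b * q i)) := by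
    intro D τ a hD ha hbD hqD hcomm
    calc τ (a * b) = τ (a * b * ∑ i, q i) := by rw [hs, mul_one]
      _ = ∑ i, τ (a * b * q i) := by rw [Finset.mul_sum, map_sum]
      _ = _ := by
        refine Finset.sum_congr rfl fun i _ => ?_
        conv_lhs => rw [← (hq i).2.1.2, ← mul_assoc]
        rw [hD.1 _ (mul_mem (mul_mem ha hbD) (hqD i)) _ (hqD i)]
        simp only [← mul_assoc]
        rw [hcomm]
  rw [expand _ τA rB hA (StarSubalgebra.mem_sup_left hrB.1) (hCA hbC)
      (fun i => StarSubalgebra.mem_sup_right (hq i).1) (fun i => hBq _ hrB.1 _ (hq i).1),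
    expand _ τC rZ hC (StarSubalgebra.mem_sup_left hrZ.1) hbC
      (fun i => StarSubalgebra.mem_sup_right (hq i).1) (fun i => hZ2 _ hrZ.1 _ (hq i).1),
    Complex.re_sum, Complex.re_sum]
  refine Finset.sum_le_sum fun i _ => ?_
  have hqi := hq i
  set q := q i
  have hpos : (q * b * q).PosSemidef := by
    have := hbp.mul_mul_conjTranspose_same q
    rwa [hqi.2.1.1.eq] at this
  obtain ⟨v, hv, hvq⟩ := hqi.exists_compress_sup hZ2 hbC
  have hvq' : q * b * q = star v * q := by
    have := congrArg star hvq
    rwa [star_mul v, hqi.2.1.star_eq, star_eq_conjTranspose, hpos.1.eq,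
      ← hZ2 _ (star_mem hv) _ hqi.1] at this
  have hu : q * b * q = ((1 / 2 : ℂ) • (v + star v)) * q := by
    rw [smul_mul_assoc, add_mul, ← hvq, ← hvq', ← two_smul ℂ, smul_smul]; norm_num
  rw [hu] at hpos ⊢
  refine IsRestriction.compare_of_compress hZ1 hZ2 h12 hA hB hC hZ hrB hrZ
    (SMulMemClass.smul_mem _ (add_mem hv (star_mem hv))) ?_ hqi hpos
  rw [IsHermitian, ← star_eq_conjTranspose, star_smul, star_add, star_star, add_comm]
  simp

end Comparison

theorem hasDerivAt_sum_mul_log {ι : Type*} [Fintype ι] (w : ι → ℝ) {a : ι → ℝ}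
    (ha : ∀ i, 0 < a i) {t : ℝ} (ht : 0 ≤ t) :
    HasDerivAt (fun t => ∑ i, w i * Real.log (a i + t)) (∑ i, w i / (a i + t)) t := by
  refine HasDerivAt.fun_sum fun i _ => ?_
  have h1 : HasDerivAt (fun t => a i + t) 1 t := (hasDerivAt_id t).const_add (a i)
  have h2 := (h1.log (by have := ha i; positivity)).const_mul (w i)
  rwa [mul_one_div] at h2

theorem tendsto_sum_mul_log_sub_log {ι : Type*} [Fintype ι] {w a : ι → ℝ}
    (ha : ∀ i, 0 < a i) (hw : ∑ i, w i = 1) :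
    Filter.Tendsto (fun t => ∑ i, w i * Real.log (a i + t) - Real.log t) Filter.atTop
      (nhds 0) := by
  have h1 : Filter.Tendsto (fun t : ℝ => ∑ i, w i * Real.log (a i / t + 1)) Filter.atTop
      (nhds (∑ i, w i * Real.log (0 + 1))) := by
    refine tendsto_finsetSum _ fun i _ => Filter.Tendsto.const_mul _ ?_
    refine Filter.Tendsto.log ?_ (by norm_num)
    exact (Filter.Tendsto.div_atTop tendsto_const_nhds Filter.tendsto_id).add_const 1
  simp only [zero_add, Real.log_one, mul_zero, Finset.sum_const_zero] at h1
  refine h1.congr' ?_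
  filter_upwards [Filter.eventually_gt_atTop 0] with t ht
  have hlog : Real.log t = ∑ i, w i * Real.log t := by rw [← Finset.sum_mul, hw, one_mul]
  conv_rhs => rw [hlog]
  rw [← Finset.sum_sub_distrib]
  refine Finset.sum_congr rfl fun i _ => ?_
  rw [← mul_sub, ← Real.log_div (by have := ha i; positivity) ht.ne', add_div, div_self ht.ne']

/-- Integrating a comparison of Stieltjes transforms gives a comparison of logarithmic moments. -/
theorem sum_mul_logb_le_of_sum_div_le {ι κ : Type*} [Fintype ι] [Fintype κ] {w a : ι → ℝ}
    {v b : κ → ℝ} (ha : ∀ i, 0 < a i) (hb : ∀ k, 0 < b k) (hw : ∑ i, w i = 1)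
    (hv : ∑ k, v k = 1) (h : ∀ t : ℝ, 0 < t → ∑ k, v k / (b k + t) ≤ ∑ i, w i / (a i + t)) :
    ∑ i, w i * Real.logb 2 (a i) ≤ ∑ k, v k * Real.logb 2 (b k) := by
  let f : ℝ → ℝ := fun t => ∑ i, w i * Real.log (a i + t) - ∑ k, v k * Real.log (b k + t)
  have hf : ∀ t : ℝ, 0 ≤ t → HasDerivAt f (∑ i, w i / (a i + t) - ∑ k, v k / (b k + t)) t :=
    fun t ht => (hasDerivAt_sum_mul_log w ha ht).sub (hasDerivAt_sum_mul_log v hb ht)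
  have hmono : MonotoneOn f (Set.Ici 0) := by
    refine monotoneOn_of_deriv_nonneg (convex_Ici 0)
      (fun t ht => (hf t ht).continuousAt.continuousWithinAt) ?_ ?_
    · intro t ht
      rw [interior_Ici] at ht
      exact (hf t (le_of_lt ht)).differentiableAt.differentiableWithinAt
    · intro t ht
      rw [interior_Ici] at ht
      rw [(hf t (le_of_lt ht)).deriv]
      exact sub_nonneg.2 (h t ht)
  have hflim : Filter.Tendsto f Filter.atTop (nhds 0) := by
    have := (tendsto_sum_mul_log_sub_log ha hw).sub (tendsto_sum_mul_log_sub_log hb hv)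
    simpa [f] using this
  have h0 : f 0 ≤ 0 := by
    refine ge_of_tendsto hflim ?_
    filter_upwards [Filter.eventually_ge_atTop 0] with t ht
    exact hmono (Set.mem_Ici.2 le_rfl) ht ht
  simp only [f, add_zero, sub_nonpos] at h0
  simp only [Real.logb, ← mul_div_assoc, ← Finset.sum_div]
  exact div_le_div_of_nonneg_right h0 (Real.log_nonneg (by norm_num))

theorem IsCanonicalTrace.mul_self_star_nonneg {A : StarSubalgebra ℂ (Matrix α α ℂ)}
    {τ : Matrix α α ℂ →ₗ[ℂ] ℂ} (hτ : IsCanonicalTrace A τ) {a y : Matrix α α ℂ} (ha : a ∈ A)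
    (hap : a.PosSemidef) (hy : y ∈ A) : 0 ≤ (τ (a * (y * star y))).re := by
  obtain ⟨ι, _, P, l, hP, -, hl, -, hae, -⟩ := hap.exists_minProj_diagonalization A ha
  rw [hae, Finset.sum_mul, map_sum, Complex.re_sum]
  refine Finset.sum_nonneg fun i _ => ?_
  rw [smul_mul_assoc, map_smul, smul_eq_mul, Complex.re_ofReal_mul]
  refine mul_nonneg (hl i) ?_
  have hPi := hP i
  have h1 : τ (P i * (y * star y)) = τ (star (star y * P i) * (star y * P i)) := by
    rw [star_mul, star_star, hPi.2.1.star_eq]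
    conv_lhs => rw [← hPi.2.1.2, mul_assoc,
      hτ.1 _ hPi.1 _ (mul_mem hPi.1 (mul_mem hy (star_mem hy)))]
    simp only [mul_assoc]
  rw [h1]
  exact (Complex.le_def.1 (hτ.2.1 _ (mul_mem (star_mem hy) hPi.1))).1

/-- The concave quadratic functional whose maximum is a resolvent moment of the relative modular
operator of `s` with respect to the state `ρ`. -/
noncomputable def modularFunctional (τ : Matrix α α ℂ →ₗ[ℂ] ℂ) (ρ s : Matrix α α ℂ) (t : ℝ)
    (x : Matrix α α ℂ) : ℝ :=
  2 * (ρ * x).trace.re - (τ (s * (x * star x))).re - t * (ρ * (star x * x)).trace.re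

theorem modularFunctional_eq {A : StarSubalgebra ℂ (Matrix α α ℂ)}
    {τ : Matrix α α ℂ →ₗ[ℂ] ℂ} (hτ : IsCanonicalTrace A τ) {ρ r s x₀ x : Matrix α α ℂ}
    (hρ : ρ.IsHermitian) (hr : IsRestriction A τ ρ r) (hs : s ∈ A) (hsh : s.IsHermitian) {t : ℝ}
    (hx₀ : x₀ ∈ A) (heq : s * x₀ + (t : ℂ) • (x₀ * r) = r) (hx : x ∈ A) :
    modularFunctional τ ρ s t x = (ρ * x₀).trace.re -
      ((τ (s * ((x - x₀) * star (x - x₀)))).re +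
        t * (ρ * (star (x - x₀) * (x - x₀))).trace.re) := by
  have hsx := star_mem hx
  have hsx₀ := star_mem hx₀
  have hrA := hr.1
  have hstar : ∀ y, (ρ * star y).trace.re = (ρ * y).trace.re := by
    intro y
    have h1 : ρ * star y = (y * ρ)ᴴ := by
      rw [conjTranspose_mul, hρ.eq, star_eq_conjTranspose]
    rw [h1, trace_conjTranspose, trace_mul_comm]
    simp
  have e1 : ∀ y ∈ A, τ (s * (x₀ * star y)) + t * (ρ * (star y * x₀)).trace =
      (ρ * star y).trace := by
    intro y hy
    have hsy := star_mem hy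
    rw [← hr.2.2 _ (mul_mem hsy hx₀), ← hr.2.2 _ hsy]
    conv_rhs => rw [← heq]
    rw [hτ.1 r hrA _ (mul_mem hsy hx₀), add_mul, smul_mul_assoc, map_add, map_smul, smul_eq_mul,
      mul_assoc (star y), hτ.1 (star y) hsy _ (mul_mem hx₀ hrA)]
    simp only [mul_assoc]
  have e2 : τ (s * (x * star x₀)) + t * (ρ * (star x₀ * x)).trace = (ρ * x).trace := by
    have heq' : star x₀ * s + (t : ℂ) • (r * star x₀) = r := by
      have := congrArg star heq
      rw [star_add, star_smul, star_mul, star_mul] at this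
      simpa [star_eq_conjTranspose, hsh.eq, hr.2.1.1.eq] using this
    rw [← hr.2.2 _ (mul_mem hsx₀ hx), ← hr.2.2 _ hx]
    conv_rhs => rw [← heq']
    rw [add_mul, smul_mul_assoc, map_add, map_smul, smul_eq_mul,
      ← mul_assoc s, hτ.1 _ (mul_mem hs hx) _ hsx₀]
    simp only [mul_assoc]
  have hd1 : s * ((x - x₀) * star (x - x₀)) = s * (x * star x) - s * (x * star x₀) -
      s * (x₀ * star x) + s * (x₀ * star x₀) := by
    rw [star_sub]; noncomm_ring
  have hd2 : ρ * (star (x - x₀) * (x - x₀)) = ρ * (star x * x) - ρ * (star x₀ * x) -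
      ρ * (star x * x₀) + ρ * (star x₀ * x₀) := by
    rw [star_sub]; noncomm_ring
  have f1 := congrArg Complex.re (e1 x hx)
  have f2 := congrArg Complex.re (e1 x₀ hx₀)
  have f3 := congrArg Complex.re e2
  rw [Complex.add_re, Complex.re_ofReal_mul] at f1 f2 f3
  rw [hstar] at f1 f2
  rw [modularFunctional, hd1, hd2]
  simp only [map_add, map_sub, trace_add, trace_sub, Complex.add_re, Complex.sub_re]
  linarith

theorem modularFunctional_le {A : StarSubalgebra ℂ (Matrix α α ℂ)}
    {τ : Matrix α α ℂ →ₗ[ℂ] ℂ} (hτ : IsCanonicalTrace A τ) {ρ r s x₀ x : Matrix α α ℂ}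
    (hρ : ρ.IsHermitian) (hr : IsRestriction A τ ρ r) (hs : s ∈ A) (hsp : s.PosSemidef) {t : ℝ}
    (ht : 0 ≤ t) (hx₀ : x₀ ∈ A) (heq : s * x₀ + (t : ℂ) • (x₀ * r) = r) (hx : x ∈ A) :
    modularFunctional τ ρ s t x ≤ (ρ * x₀).trace.re := by
  rw [modularFunctional_eq hτ hρ hr hs hsp.1 hx₀ heq hx]
  have hy : x - x₀ ∈ A := sub_mem hx hx₀
  have h1 := hτ.mul_self_star_nonneg hs hsp hy
  have h2 := hτ.mul_self_star_nonneg hr.1 hr.2.1 (star_mem hy)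
  rw [star_star, hr.2.2 _ (mul_mem (star_mem hy) hy)] at h2
  have := mul_nonneg ht h2
  linarith

/-- The spectral measure of the relative modular operator of the restrictions of a state to an
algebra `A` and a subalgebra `B`. -/
theorem exists_modular_spectral_measure {A B : StarSubalgebra ℂ (Matrix α α ℂ)} (hBA : B ≤ A)
    {τ σ : Matrix α α ℂ →ₗ[ℂ] ℂ} (hτ : IsCanonicalTrace A τ)
    {ρ r s : Matrix α α ℂ} (hρ : ρ.trace = 1) (hr : IsRestriction A τ ρ r)
    (hs : IsRestriction B σ ρ s) :
    ∃ (κ : Type) (_ : Fintype κ) (w a : κ → ℝ), (∀ k, 0 < a k) ∧ ∑ k, w k = 1 ∧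
      ∑ k, w k * Real.logb 2 (a k) =
        (ρ * matLogb s).trace.re - (ρ * matLogb r).trace.re ∧
      ∀ t : ℝ, 0 < t → ∃ x₀ ∈ A, s * x₀ + (t : ℂ) • (x₀ * r) = r ∧
        (ρ * x₀).trace.re = ∑ k, w k / (a k + t) := by
  obtain ⟨ι, _, p, l, hp, hp1, hl, hsp, hse, hsl⟩ :=
    hs.2.1.exists_minProj_diagonalization B hs.1
  obtain ⟨κ, _, q, m, hq, hq1, hm, hrq, hre, hrl⟩ :=
    hr.2.1.exists_minProj_diagonalization A hr.1
  have hpA : ∀ i, p i ∈ A := fun i => hBA (hp i).1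
  have hqr : ∀ j, q j * r = (m j : ℂ) • q j := by
    intro j
    have := congrArg star (hrq j)
    rw [star_mul, star_smul, (hq j).2.1.star_eq, star_eq_conjTranspose, hr.2.1.1.eq] at this
    simpa using this
  let w : ι × κ → ℝ := fun x => (ρ * (p x.1 * q x.2)).trace.re
  have hw : ∀ i j, w (i, j) = m j * (τ (star (p i * q j) * (p i * q j))).re := by
    intro i j
    have hpq := mul_mem (hpA i) (hq j).1
    simp only [w]
    rw [← hr.2.2 _ hpq, hτ.1 r hr.1 _ hpq, mul_assoc, hqr, mul_smul_comm, map_smul, smul_eq_mul,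
      Complex.re_ofReal_mul, star_mul, (hp i).2.1.star_eq, (hq j).2.1.star_eq, mul_assoc,
      ← mul_assoc (p i), (hp i).2.1.2, hτ.1 _ (hq j).1 _ hpq, mul_assoc, (hq j).2.1.2]
  have hw0 : ∀ x, 0 ≤ w x := by
    rintro ⟨i, j⟩
    rw [hw]
    exact mul_nonneg (hm j) (Complex.le_def.1 (hτ.2.1 _ (mul_mem (hpA i) (hq j).1))).1
  have hwm : ∀ i j, w (i, j) ≠ 0 → 0 < m j := by
    intro i j h
    refine lt_of_le_of_ne (hm j) fun h0 => h ?_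
    rw [hw, ← h0, zero_mul]
  have hwsum₂ : ∀ i, ∑ j, w (i, j) = (ρ * p i).trace.re := by
    intro i
    simp only [w]
    rw [← Complex.re_sum, ← trace_sum, ← Finset.mul_sum, ← Finset.mul_sum, hq1, mul_one]
  have hwsum₁ : ∀ j, ∑ i, w (i, j) = (ρ * q j).trace.re := by
    intro j
    simp only [w]
    rw [← Complex.re_sum, ← trace_sum, ← Finset.mul_sum, ← Finset.sum_mul, hp1, one_mul]
  have hwl : ∀ i j, w (i, j) ≠ 0 → 0 < l i := by
    intro i j h
    refine lt_of_le_of_ne (hl i) fun h0 => h ?_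
    have h1 : ∑ j, w (i, j) = 0 := by
      rw [hwsum₂, ← hs.2.2 _ (hp i).1, hsp, ← h0]; simp
    exact (Finset.sum_eq_zero_iff_of_nonneg (fun j _ => hw0 (i, j))).1 h1 j (Finset.mem_univ _)
  refine ⟨ι × κ, inferInstance, w, fun x => if w x = 0 then 1 else l x.1 / m x.2, ?_, ?_, ?_, ?_⟩
  · rintro ⟨i, j⟩
    dsimp only
    split_ifs with h
    · exact one_pos
    · exact div_pos (hwl i j h) (hwm i j h)
  · rw [Fintype.sum_prod_type]
    simp only [hwsum₂]
    rw [← Complex.re_sum, ← trace_sum, ← Finset.mul_sum, hp1, mul_one, hρ, Complex.one_re]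
  · have h1 : ∀ x, w x * Real.logb 2 (if w x = 0 then 1 else l x.1 / m x.2) =
        w x * Real.logb 2 (l x.1) - w x * Real.logb 2 (m x.2) := by
      rintro ⟨i, j⟩
      split_ifs with h
      · simp [h]
      · rw [Real.logb_div (hwl i j h).ne' (hwm i j h).ne', mul_sub]
    simp only [h1]
    rw [Finset.sum_sub_distrib, Fintype.sum_prod_type, Fintype.sum_prod_type_right]
    simp only [← Finset.sum_mul, hwsum₁, hwsum₂]
    rw [hsl, hrl, Finset.mul_sum, Finset.mul_sum, trace_sum, trace_sum, Complex.re_sum,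
      Complex.re_sum]
    simp only [mul_smul_comm, trace_smul, smul_eq_mul, Complex.re_ofReal_mul]
    simp only [mul_comm]
  · intro t ht
    let c : ι → κ → ℝ := fun i j => m j / (l i + t * m j)
    have hc : ∀ i j, (l i + t * m j) * c i j = m j := by
      intro i j
      by_cases h0 : l i + t * m j = 0
      · have h1 := hl i
        have h2 := mul_nonneg ht.le (hm j)
        have h3 : t * m j = 0 := by linarith
        rw [h0, zero_mul, (mul_eq_zero.1 h3).resolve_left ht.ne']
      · exact mul_div_cancel₀ _ h0
    refine ⟨∑ i, ∑ j, (c i j : ℂ) • (p i * q j), sum_mem fun i _ => sum_mem fun j _ =>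
      SMulMemClass.smul_mem _ (mul_mem (hpA i) (hq j).1), ?_, ?_⟩
    · have hr' : r = ∑ i, ∑ j, (m j : ℂ) • (p i * q j) := by
        rw [Finset.sum_comm]
        simp only [← Finset.smul_sum, ← Finset.sum_mul, hp1, one_mul]
        exact hre
      conv_rhs => rw [hr']
      simp only [Finset.mul_sum, Finset.sum_mul, Finset.smul_sum, ← Finset.sum_add_distrib]
      refine Finset.sum_congr rfl fun i _ => Finset.sum_congr rfl fun j _ => ?_
      rw [mul_smul_comm, ← mul_assoc, hsp, smul_mul_assoc, smul_mul_assoc, mul_assoc, hqr,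
        mul_smul_comm, smul_smul, smul_smul, smul_smul, ← add_smul]
      congr 1
      have := congrArg (fun z : ℝ => (z : ℂ)) (hc i j)
      push_cast at this
      linear_combination this
    · rw [Fintype.sum_prod_type]
      simp only [Finset.mul_sum, trace_sum, Complex.re_sum, mul_smul_comm, trace_smul,
        smul_eq_mul, Complex.re_ofReal_mul]
      refine Finset.sum_congr rfl fun i _ => Finset.sum_congr rfl fun j _ => ?_
      change c i j * w (i, j) = _
      split_ifs with h
      · simp [h]
      · have h1 := hwl i j h
        have h2 := hwm i j h
        simp only [c]
        field_simp

theorem IsAlgEntropy.exists_eq {X : StarSubalgebra ℂ (Matrix α α ℂ)} {ρ : Matrix α α ℂ} {H : ℝ}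
    (h : IsAlgEntropy X ρ H) : ∃ τ r, IsCanonicalTrace X τ ∧ IsRestriction X τ ρ r ∧
      H = -(ρ * matLogb r).trace.re := by
  obtain ⟨τ, r, hτ, hr, rfl⟩ := h
  obtain ⟨ι, _, P, l, hP, -, -, -, -, hlog⟩ := hr.2.1.exists_minProj_diagonalization X hr.1
  refine ⟨τ, r, hτ, hr, ?_⟩
  rw [algEntropy, hr.2.2]
  rw [hlog]
  exact sum_mem fun i _ => SMulMemClass.smul_mem _ (hP i).1

/-- Strong subadditivity of entropy for commuting matrix algebras. -/
theorem IsAlgEntropy.strong_subadditivity {ρ : Matrix α α ℂ} (hρ : MatState ρ)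
    {Z Y₁ Y₂ : StarSubalgebra ℂ (Matrix α α ℂ)} (hZ1 : CompatibleAlg Z Y₁)
    (hZ2 : CompatibleAlg Z Y₂) (h12 : CompatibleAlg Y₁ Y₂) {HZ HB HC HA : ℝ}
    (hZ : IsAlgEntropy Z ρ HZ) (hB : IsAlgEntropy (Z ⊔ Y₁) ρ HB)
    (hC : IsAlgEntropy (Z ⊔ Y₂) ρ HC) (hA : IsAlgEntropy (Z ⊔ Y₁ ⊔ Y₂) ρ HA) :
    HZ + HA ≤ HB + HC := by
  obtain ⟨τZ, rZ, hτZ, hrZ, rfl⟩ := hZ.exists_eq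
  obtain ⟨τB, rB, hτB, hrB, rfl⟩ := hB.exists_eq
  obtain ⟨τC, rC, hτC, hrC, rfl⟩ := hC.exists_eq
  obtain ⟨τA, rA, hτA, hrA, rfl⟩ := hA.exists_eq
  have hCA : Z ⊔ Y₂ ≤ Z ⊔ Y₁ ⊔ Y₂ := sup_le_sup_right le_sup_left _
  obtain ⟨κ, _, w, a, ha, hw, hwa, hG⟩ :=
    exists_modular_spectral_measure (le_sup_left : Z ⊔ Y₁ ≤ Z ⊔ Y₁ ⊔ Y₂) hτA hρ.2 hrA hrB
  obtain ⟨κ', _, v, b, hb, hv, hvb, hG'⟩ :=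
    exists_modular_spectral_measure (le_sup_left : Z ≤ Z ⊔ Y₂) hτC hρ.2 hrC hrZ
  have key := sum_mul_logb_le_of_sum_div_le ha hb hw hv fun t ht => by
    obtain ⟨x, hx, hxe, hxv⟩ := hG t ht
    obtain ⟨y, hy, hye, hyv⟩ := hG' t ht
    rw [← hxv, ← hyv]
    have h1 := modularFunctional_eq hτC hρ.1.1 hrC (StarSubalgebra.mem_sup_left hrZ.1)
      hrZ.2.1.1 hy hye hy
    have h2 := modularFunctional_le hτA hρ.1.1 hrA (StarSubalgebra.mem_sup_left hrB.1)
      hrB.2.1 ht.le hx hxe (hCA hy)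
    have h3 := IsRestriction.compare hZ1 hZ2 h12 hτA hτB hτC hτZ hrB hrZ hy
    simp only [sub_self, zero_mul, mul_zero, map_zero, trace_zero, Complex.zero_re, add_zero,
      sub_zero] at h1
    simp only [modularFunctional] at h1 h2
    linarith
  linarith

theorem isAlgEntropy_bot {ρ : Matrix α α ℂ} (hρ : MatState ρ) : IsAlgEntropy ⊥ ρ 0 := by
  have hne : Nonempty α := by
    by_contra h
    rw [not_nonempty_iff] at h
    simpa [Matrix.trace] using hρ.2
  have hcard : (Fintype.card α : ℂ) ≠ 0 := by exact_mod_cast Fintype.card_ne_zero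
  have hmem : ∀ x ∈ (⊥ : StarSubalgebra ℂ (Matrix α α ℂ)), ∃ c : ℂ, x = c • 1 := by
    intro x hx
    obtain ⟨c, rfl⟩ := StarSubalgebra.mem_bot.1 hx
    exact ⟨c, Algebra.algebraMap_eq_smul_one c⟩
  have hmin : ∀ p, IsMinProjOf (⊥ : StarSubalgebra ℂ (Matrix α α ℂ)) p → p = 1 := by
    intro p hp
    obtain ⟨c, hc⟩ := hmem p hp.1
    have hc0 : c ≠ 0 := fun h => hp.2.2.1 (by rw [hc, h, zero_smul])
    have h := hp.2.1.2
    conv_lhs at h => rw [hc]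
    rw [smul_mul_assoc, one_mul] at h
    rw [hc, smul_smul] at h
    have h1 : c * c = c := by
      have := congrArg Matrix.trace h
      rw [trace_smul, trace_smul, trace_one, smul_eq_mul, smul_eq_mul] at this
      exact mul_right_cancel₀ hcard this
    rw [hc, mul_left_cancel₀ hc0 (h1.trans (mul_one c).symm), one_smul]
  let τ : Matrix α α ℂ →ₗ[ℂ] ℂ := (Fintype.card α : ℂ)⁻¹ • Matrix.traceLinearMap α ℂ ℂ
  have hτ : ∀ x, τ x = (Fintype.card α : ℂ)⁻¹ * x.trace := fun x => by simp [τ]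
  have hτ1 : τ 1 = 1 := by rw [hτ, trace_one, inv_mul_cancel₀ hcard]
  refine ⟨τ, 1, ⟨fun x _ y _ => ?_, fun x _ => ?_, fun p hp => ?_⟩, ⟨one_mem _, .one,
    fun x hx => ?_⟩, ?_⟩
  · rw [hτ, hτ, trace_mul_comm]
  · rw [hτ]
    refine mul_nonneg ?_ (posSemidef_conjTranspose_mul_self x).trace_nonneg
    rw [inv_nonneg]
    exact Nat.cast_nonneg _
  · rw [hmin p hp, hτ1]
  · obtain ⟨c, rfl⟩ := hmem x hx
    rw [one_mul, map_smul, hτ1, mul_smul_comm, mul_one, trace_smul, hρ.2]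
  · obtain ⟨ι, _, P, l, hP, -, -, he, -, hlog⟩ :=
      (Matrix.PosSemidef.one (n := α) (R := ℂ)).exists_minProj_diagonalization ⊥ (one_mem _)
    have hl : ∀ i, l i = 1 := by
      intro i
      have h := congrArg τ (he i)
      rw [hmin _ (hP i), mul_one, map_smul, hτ1, smul_eq_mul, mul_one] at h
      exact_mod_cast h.symm
    rw [algEntropy, hlog]
    simp [hl]

theorem IsAlgEntropy.subadditivity {ρ : Matrix α α ℂ} (hρ : MatState ρ)
    {X Y : StarSubalgebra ℂ (Matrix α α ℂ)} (hXY : CompatibleAlg X Y) {HX HY HXY : ℝ}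
    (hX : IsAlgEntropy X ρ HX) (hY : IsAlgEntropy Y ρ HY)
    (hXYe : IsAlgEntropy (X ⊔ Y) ρ HXY) : HXY ≤ HX + HY := by
  have hbot : ∀ K : StarSubalgebra ℂ (Matrix α α ℂ), CompatibleAlg ⊥ K := by
    intro K x hx k _
    obtain ⟨c, rfl⟩ := StarSubalgebra.mem_bot.1 hx
    exact Algebra.commutes c k
  have := IsAlgEntropy.strong_subadditivity hρ (hbot X) (hbot Y) hXY (isAlgEntropy_bot hρ)
    (by rwa [bot_sup_eq]) (by rwa [bot_sup_eq]) (by rwa [bot_sup_eq])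
  linarith

end AlgebraicEntropy

/-- conditional subadditivity of mutual information:
if `I_ρ(𝔜₁∧𝔛₂𝔜₂|𝔛₁) = 0` and `I_ρ(𝔜₂∧𝔛₁𝔜₁|𝔛₂) = 0` then
`I_ρ(𝔛₁𝔛₂∧𝔜₁𝔜₂) ≤ I_ρ(𝔛₁∧𝔜₁) + I_ρ(𝔛₂∧𝔜₂)`. -/
theorem conditional_subadditivity_of_information {n : ℕ}
    (ρ : Matrix (Fin n) (Fin n) ℂ) (hρ : MatState ρ)
    (𝔛₁ 𝔛₂ 𝔜₁ 𝔜₂ : StarSubalgebra ℂ (Matrix (Fin n) (Fin n) ℂ))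
    (hX1X2 : CompatibleAlg 𝔛₁ 𝔛₂) (hX1Y1 : CompatibleAlg 𝔛₁ 𝔜₁)
    (hX1Y2 : CompatibleAlg 𝔛₁ 𝔜₂) (hX2Y1 : CompatibleAlg 𝔛₂ 𝔜₁)
    (hX2Y2 : CompatibleAlg 𝔛₂ 𝔜₂) (hY1Y2 : CompatibleAlg 𝔜₁ 𝔜₂)
    -- entropies of all the relevant joins, with respect to ρ
    (HX1 HX2 HY1 HY2 HX1Y1 HX2Y2 HX1X2 HY1Y2 Hall HY1X2Y2X1 HY2X1Y1X2 : ℝ)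
    (hHX1 : IsAlgEntropy 𝔛₁ ρ HX1) (hHX2 : IsAlgEntropy 𝔛₂ ρ HX2)
    (hHY1 : IsAlgEntropy 𝔜₁ ρ HY1) (hHY2 : IsAlgEntropy 𝔜₂ ρ HY2)
    (hHX1Y1 : IsAlgEntropy (𝔛₁ ⊔ 𝔜₁) ρ HX1Y1)
    (hHX2Y2 : IsAlgEntropy (𝔛₂ ⊔ 𝔜₂) ρ HX2Y2)
    (hHX1X2 : IsAlgEntropy (𝔛₁ ⊔ 𝔛₂) ρ HX1X2)
    (hHY1Y2 : IsAlgEntropy (𝔜₁ ⊔ 𝔜₂) ρ HY1Y2)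
    (hHall : IsAlgEntropy (𝔛₁ ⊔ 𝔛₂ ⊔ 𝔜₁ ⊔ 𝔜₂) ρ Hall)
    (hHY1X2Y2X1 : IsAlgEntropy (𝔛₂ ⊔ 𝔜₂ ⊔ 𝔛₁) ρ HY1X2Y2X1)
    (hHY2X1Y1X2 : IsAlgEntropy (𝔛₁ ⊔ 𝔜₁ ⊔ 𝔛₂) ρ HY2X1Y1X2)
    -- the two conditional-independence hypotheses
    -- I(𝔜₁ ∧ 𝔛₂𝔜₂ | 𝔛₁) = H(𝔜₁𝔛₁) + H(𝔛₂𝔜₂𝔛₁) − H(𝔜₁𝔛₂𝔜₂𝔛₁) − H(𝔛₁) = 0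
    (hci1 : HX1Y1 + HY1X2Y2X1 - Hall - HX1 = 0)
    -- I(𝔜₂ ∧ 𝔛₁𝔜₁ | 𝔛₂) = H(𝔜₂𝔛₂) + H(𝔛₁𝔜₁𝔛₂) − H(𝔜₂𝔛₁𝔜₁𝔛₂) − H(𝔛₂) = 0
    (hci2 : HX2Y2 + HY2X1Y1X2 - Hall - HX2 = 0) :
    (HX1X2 + HY1Y2 - Hall) ≤
      (HX1 + HY1 - HX1Y1) + (HX2 + HY2 - HX2Y2) := by
  have hZ1 : CompatibleAlg (𝔛₁ ⊔ 𝔛₂) 𝔜₁ := hX1X2.sup_left hX1Y1 hX2Y1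
  have hZ2 : CompatibleAlg (𝔛₁ ⊔ 𝔛₂) 𝔜₂ := hX1X2.sup_left hX1Y2 hX2Y2
  have hssa := IsAlgEntropy.strong_subadditivity hρ hZ1 hZ2 hY1Y2 hHX1X2
    (by rwa [sup_right_comm])
    (show IsAlgEntropy _ ρ HY1X2Y2X1 by rwa [sup_assoc, sup_comm]) hHall
  have hsub := IsAlgEntropy.subadditivity hρ hY1Y2 hHY1 hHY2 hHY1Y2
  linarith
end

section
/- Let 𝒳₁,…,𝒳_n be finite sets, P a probability distribution on 𝒳₁×⋯×𝒳_n, and for each k let W^k assign to each x ∈ 𝒳_k a density matrix W^k_x on M_{m_k}(ℂ). Consider the state γ = Σ_{x₁,…,x_n} P(x₁,…,x_n)·[x₁]⊗⋯⊗[x_n]⊗W¹_{x₁}⊗⋯⊗Wⁿ_{x_n} on ℂ^{𝒳₁}⊗⋯⊗ℂ^{𝒳_n}⊗M_{m₁}(ℂ)⊗⋯⊗M_{m_n}(ℂ), where [x] denotes the diagonal rank-one projection onto the basis vector x. Let 𝔛_k and 𝔜_k denote the tensor-factor subalgebras corresponding to ℂ^{𝒳_k} and M_{m_k}(ℂ),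 respectively. Then I_γ(𝔛₁⋯𝔛_n ∧ 𝔜₁⋯𝔜_n) ≤ Σ_{k=1}^n I_γ(𝔛_k ∧ 𝔜_k). -/
open scoped ComplexOrder Kronecker
open Matrix

section Statement14

variable {nn : ℕ} {𝒳 : Fin nn → Type} [∀ k, Fintype (𝒳 k)] [∀ k, DecidableEq (𝒳 k)]
  {m : Fin nn → ℕ}

/-- The classical–quantum state
`γ = ∑_x P(x) [x₁]⊗⋯⊗[x_n]⊗W¹_{x₁}⊗⋯⊗Wⁿ_{x_n}` on
`ℂ^{𝒳₁}⊗⋯⊗ℂ^{𝒳_n}⊗M_{m₁}(ℂ)⊗⋯⊗M_{m_n}(ℂ)`. -/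
noncomputable def cqMultiState (P : (∀ k, 𝒳 k) → ℝ)
    (W : ∀ k, 𝒳 k → Matrix (Fin (m k)) (Fin (m k)) ℂ) :
    Matrix ((∀ k, 𝒳 k) × (∀ k, Fin (m k))) ((∀ k, 𝒳 k) × (∀ k, Fin (m k))) ℂ :=
  Matrix.of fun p q =>
    if p.1 = q.1 then (P p.1 : ℂ) * ∏ k, W k (p.1 k) (p.2 k) (q.2 k) else 0

/-- The tensor-factor subalgebra corresponding to the classical factor `ℂ^{𝒳_k}`. -/
noncomputable def classicalFactor (𝒳 : Fin nn → Type) [∀ k, Fintype (𝒳 k)]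
    [∀ k, DecidableEq (𝒳 k)] (m : Fin nn → ℕ) (k : Fin nn) :
    StarSubalgebra ℂ
      (Matrix ((∀ k, 𝒳 k) × (∀ k, Fin (m k))) ((∀ k, 𝒳 k) × (∀ k, Fin (m k))) ℂ) :=
  StarAlgebra.adjoin ℂ
    {A | ∃ d : 𝒳 k → ℂ, A = Matrix.diagonal (fun p => d (p.1 k))}

/-- The tensor-factor subalgebra corresponding to the quantum factor `M_{m_k}(ℂ)`. -/
noncomputable def quantumFactor (𝒳 : Fin nn → Type) [∀ k, Fintype (𝒳 k)]
    [∀ k, DecidableEq (𝒳 k)] (m : Fin nn → ℕ) (k : Fin nn) :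
    StarSubalgebra ℂ
      (Matrix ((∀ k, 𝒳 k) × (∀ k, Fin (m k))) ((∀ k, 𝒳 k) × (∀ k, Fin (m k))) ℂ) :=
  StarAlgebra.adjoin ℂ
    {A | ∃ y : Matrix (Fin (m k)) (Fin (m k)) ℂ,
      A = Matrix.of fun p q =>
        if p.1 = q.1 ∧ ∀ l, l ≠ k → p.2 l = q.2 l then y (p.2 k) (q.2 k) else 0}

section Entropy

variable {α : Type*} [Fintype α] [DecidableEq α]

/-- The von Neumann entropy `-Tr (A log A)`. -/
noncomputable def traceEntropy (A : Matrix α α ℂ) : ℝ := -(A * matLogb A).trace.re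

theorem exists_polynomial_eval_eq_logb (s : Finset ℝ) :
    ∃ p : Polynomial ℂ, ∀ x ∈ s, p.eval (x : ℂ) = (Real.logb 2 x : ℂ) := by
  refine ⟨Lagrange.interpolate s (fun x : ℝ => (x : ℂ)) (fun x => (Real.logb 2 x : ℂ)), ?_⟩
  intro x hx
  exact Lagrange.eval_interpolate_at_node _ (Complex.ofReal_injective.injOn) hx

theorem aeval_diagonal (a : α → ℂ) (p : Polynomial ℂ) :
    Polynomial.aeval (diagonal a) p = diagonal (fun i => p.eval (a i)) := by
  have h := Polynomial.aeval_algHom_apply (diagonalAlgHom (n := α) (α := ℂ) ℂ) a p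
  rw [diagonalAlgHom_apply, diagonalAlgHom_apply] at h
  rw [h, Polynomial.aeval_pi_apply]
  simp [Polynomial.coe_aeval_eq_eval]

theorem aeval_unitary_conj (U : unitary (Matrix α α ℂ)) (A : Matrix α α ℂ)
    (p : Polynomial ℂ) :
    Polynomial.aeval ((U : Matrix α α ℂ) * A * star (U : Matrix α α ℂ)) p =
      (U : Matrix α α ℂ) * Polynomial.aeval A p * star (U : Matrix α α ℂ) := by
  have h := Polynomial.aeval_algHom_apply (Unitary.conjStarAlgAut ℂ _ U) A p
  simpa [Unitary.conjStarAlgAut_apply] using h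

theorem Matrix.IsHermitian.eq_conj_diagonal {A : Matrix α α ℂ} (hA : A.IsHermitian) :
    A = (hA.eigenvectorUnitary : Matrix α α ℂ) *
      diagonal (fun i => (hA.eigenvalues i : ℂ)) *
      star (hA.eigenvectorUnitary : Matrix α α ℂ) := by
  have h := hA.spectral_theorem
  rw [Unitary.conjStarAlgAut_apply] at h
  exact h

theorem matLogb_eq_aeval {A : Matrix α α ℂ} (hA : A.IsHermitian) (p : Polynomial ℂ)
    (hp : ∀ i, p.eval (hA.eigenvalues i : ℂ) = (Real.logb 2 (hA.eigenvalues i) : ℂ)) :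
    matLogb A = Polynomial.aeval A p := by
  conv_rhs => rw [hA.eq_conj_diagonal]
  rw [aeval_unitary_conj, aeval_diagonal, matLogb, dif_pos hA]
  simp only [hp]

theorem isHermitian_unitary_conj (U : unitary (Matrix α α ℂ)) (a : α → ℝ) :
    ((U : Matrix α α ℂ) * diagonal (fun i => (a i : ℂ)) *
      star (U : Matrix α α ℂ)).IsHermitian := by
  refine isHermitian_mul_mul_conjTranspose _ ?_
  rw [isHermitian_diagonal_iff]
  intro i
  exact Complex.conj_ofReal _

theorem traceEntropy_conj_diagonal (U : unitary (Matrix α α ℂ)) (a : α → ℝ) :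
    traceEntropy ((U : Matrix α α ℂ) * diagonal (fun i => (a i : ℂ)) *
      star (U : Matrix α α ℂ)) = ∑ i, negMulLogb (a i) := by
  set A := (U : Matrix α α ℂ) * diagonal (fun i => (a i : ℂ)) * star (U : Matrix α α ℂ) with hAdef
  have hA : A.IsHermitian := isHermitian_unitary_conj U a
  obtain ⟨p, hp⟩ := exists_polynomial_eval_eq_logb
    (Finset.univ.image a ∪ Finset.univ.image hA.eigenvalues)
  have hU : star (U : Matrix α α ℂ) * (U : Matrix α α ℂ) = 1 := Unitary.coe_star_mul_self U
  rw [traceEntropy, matLogb_eq_aeval hA p (fun i => hp _ (by simp)), hAdef, aeval_unitary_conj,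
    aeval_diagonal]
  have hpa : ∀ i, p.eval (a i : ℂ) = (Real.logb 2 (a i) : ℂ) := fun i => hp _ (by simp)
  simp only [hpa]
  have : (U : Matrix α α ℂ) * diagonal (fun i => (a i : ℂ)) * star (U : Matrix α α ℂ) *
      ((U : Matrix α α ℂ) * diagonal (fun i => (Real.logb 2 (a i) : ℂ)) *
        star (U : Matrix α α ℂ)) =
      (U : Matrix α α ℂ) * (diagonal (fun i => (a i : ℂ)) *
        diagonal (fun i => (Real.logb 2 (a i) : ℂ)) * star (U : Matrix α α ℂ)) := by
    simp only [Matrix.mul_assoc]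
    rw [← Matrix.mul_assoc (star (U : Matrix α α ℂ)) (U : Matrix α α ℂ), hU, Matrix.one_mul]
  rw [this, trace_mul_comm, Matrix.mul_assoc, hU, Matrix.mul_one, diagonal_mul_diagonal,
    trace_diagonal]
  simp [negMulLogb]

theorem traceEntropy_eq_sum_eigenvalues {A : Matrix α α ℂ} (hA : A.IsHermitian) :
    traceEntropy A = ∑ i, negMulLogb (hA.eigenvalues i) := by
  conv_lhs => rw [hA.eq_conj_diagonal]
  exact traceEntropy_conj_diagonal _ _

theorem negMulLogb_mul (x y : ℝ) :
    negMulLogb (x * y) = x * negMulLogb y + y * negMulLogb x := by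
  unfold negMulLogb
  rcases eq_or_ne x 0 with rfl | hx
  · simp
  rcases eq_or_ne y 0 with rfl | hy
  · simp
  rw [Real.logb_mul hx hy]
  ring

theorem negMulLogb_eq (x : ℝ) : negMulLogb x = (Real.log 2)⁻¹ * Real.negMulLog x := by
  simp only [negMulLogb, Real.negMulLog, Real.logb]
  ring

theorem concaveOn_negMulLogb : ConcaveOn ℝ (Set.Ici (0 : ℝ)) negMulLogb := by
  have h := Real.concaveOn_negMulLog.smul (c := (Real.log 2)⁻¹)
    (inv_nonneg.2 (Real.log_nonneg one_le_two))
  rwa [show negMulLogb = fun x => (Real.log 2)⁻¹ • Real.negMulLog x from funext negMulLogb_eq]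

theorem Matrix.IsHermitian.sum_eigenvalues {A : Matrix α α ℂ} (hA : A.IsHermitian)
    (h1 : A.trace = 1) : ∑ i, hA.eigenvalues i = 1 := by
  have h := hA.trace_eq_sum_eigenvalues
  rw [h1] at h
  simp only [Complex.coe_algebraMap] at h
  exact_mod_cast h.symm

theorem traceEntropy_smul_state {A : Matrix α α ℂ} (hA : MatState A) (c : ℝ) :
    traceEntropy ((c : ℂ) • A) = c * traceEntropy A + negMulLogb c := by
  have hH := hA.1.isHermitian
  have h : (c : ℂ) • A = (hH.eigenvectorUnitary : Matrix α α ℂ) *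
      diagonal (fun i => ((c * hH.eigenvalues i : ℝ) : ℂ)) *
      star (hH.eigenvectorUnitary : Matrix α α ℂ) := by
    conv_lhs => rw [hH.eq_conj_diagonal, ← Matrix.smul_mul, ← Matrix.mul_smul, ← diagonal_smul]
    simp [Pi.smul_def]
  rw [h, traceEntropy_conj_diagonal, traceEntropy_eq_sum_eigenvalues hH, Finset.mul_sum]
  simp only [negMulLogb_mul]
  rw [Finset.sum_add_distrib, ← Finset.sum_mul, hH.sum_eigenvalues hA.2, one_mul]

theorem traceEntropy_unit (c : ℝ) :
    traceEntropy ((c : ℂ) • (1 : Matrix Unit Unit ℂ)) = negMulLogb c := by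
  have h := traceEntropy_conj_diagonal (1 : unitary (Matrix Unit Unit ℂ)) (fun _ => c)
  have hd : diagonal (fun _ : Unit => (c : ℂ)) = (c : ℂ) • (1 : Matrix Unit Unit ℂ) := by
    ext i j; simp
  simpa [hd] using h

/-- The entropy of a state is at most the Shannon entropy of its diagonal in any orthonormal
basis. -/
theorem traceEntropy_le_diag {A : Matrix α α ℂ} (hA : A.PosSemidef)
    (V : unitary (Matrix α α ℂ)) :
    traceEntropy A ≤
      ∑ i, negMulLogb ((star (V : Matrix α α ℂ) * A * (V : Matrix α α ℂ)) i i).re := by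
  have hH := hA.isHermitian
  set T : unitary (Matrix α α ℂ) := star V * hH.eigenvectorUnitary with hT
  have hTc : (T : Matrix α α ℂ) = star (V : Matrix α α ℂ) * hH.eigenvectorUnitary := rfl
  have hconj : star (V : Matrix α α ℂ) * A * (V : Matrix α α ℂ) =
      (T : Matrix α α ℂ) * diagonal (fun i => (hH.eigenvalues i : ℂ)) *
        star (T : Matrix α α ℂ) := by
    conv_lhs => rw [hH.eq_conj_diagonal]
    rw [hTc, star_mul, star_star]
    simp only [Matrix.mul_assoc]
  have hentry : ∀ i, ((star (V : Matrix α α ℂ) * A * (V : Matrix α α ℂ)) i i).re =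
      ∑ j, Complex.normSq ((T : Matrix α α ℂ) i j) • hH.eigenvalues j := by
    intro i
    rw [hconj, mul_apply, Complex.re_sum]
    refine Finset.sum_congr rfl fun j _ => ?_
    rw [mul_diagonal, star_apply, mul_right_comm, RCLike.star_def, Complex.mul_conj]
    rw [smul_eq_mul, ← Complex.ofReal_mul, Complex.ofReal_re]
  have hrow : ∀ i, ∑ j, Complex.normSq ((T : Matrix α α ℂ) i j) = 1 := by
    intro i
    have h : ((T : Matrix α α ℂ) * star (T : Matrix α α ℂ)) i i = 1 := by
      rw [Unitary.mul_star_self_of_mem T.2, one_apply_eq]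
    rw [mul_apply] at h
    simp only [star_apply, RCLike.star_def, Complex.mul_conj] at h
    exact_mod_cast h
  have hcol : ∀ j, ∑ i, Complex.normSq ((T : Matrix α α ℂ) i j) = 1 := by
    intro j
    have h : (star (T : Matrix α α ℂ) * (T : Matrix α α ℂ)) j j = 1 := by
      rw [Unitary.coe_star_mul_self, one_apply_eq]
    rw [mul_apply] at h
    simp only [star_apply, RCLike.star_def, ← Complex.normSq_eq_conj_mul_self] at h
    exact_mod_cast h
  calc traceEntropy A = ∑ j, negMulLogb (hH.eigenvalues j) := traceEntropy_eq_sum_eigenvalues hH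
    _ = ∑ i, ∑ j, Complex.normSq ((T : Matrix α α ℂ) i j) • negMulLogb (hH.eigenvalues j) := by
      rw [Finset.sum_comm]
      refine Finset.sum_congr rfl fun j _ => ?_
      rw [← Finset.sum_smul, hcol, one_smul]
    _ ≤ _ := by
      refine Finset.sum_le_sum fun i _ => ?_
      rw [hentry]
      exact concaveOn_negMulLogb.le_map_sum (fun j _ => Complex.normSq_nonneg _) (hrow i)
        (fun j _ => hA.eigenvalues_nonneg j)

end Entropy

section Classical

theorem mul_log_sub_le {q t : ℝ} (hq : 0 ≤ q) (ht : 0 ≤ t) (h : t = 0 → q = 0) :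
    q * Real.log t - q * Real.log q ≤ t - q := by
  rcases hq.eq_or_lt with rfl | hq'
  · simpa using ht
  have ht' : 0 < t := lt_of_le_of_ne ht fun h0 => hq'.ne' (h h0.symm)
  have h1 := Real.log_le_sub_one_of_pos (div_pos ht' hq')
  rw [Real.log_div ht'.ne' hq'.ne'] at h1
  have h2 := mul_le_mul_of_nonneg_left h1 hq
  have h3 : q * (t / q - 1) = t - q := by field_simp
  linarith

variable {κ : Type*} [Fintype κ] [DecidableEq κ] {n : κ → Type*} [∀ k, Fintype (n k)]
  [∀ k, DecidableEq (n k)]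

/-- Subadditivity of Shannon entropy. -/
theorem sum_negMulLogb_le_sum_marginals (q : (∀ k, n k) → ℝ) (hq : ∀ i, 0 ≤ q i)
    (hq1 : ∑ i, q i = 1) (μ : ∀ k, n k → ℝ)
    (hμ : ∀ k j, μ k j = ∑ i, if i k = j then q i else 0) :
    ∑ i, negMulLogb (q i) ≤ ∑ k, ∑ j, negMulLogb (μ k j) := by
  have hμ0 : ∀ k j, 0 ≤ μ k j := fun k j => by
    rw [hμ]; exact Finset.sum_nonneg fun i _ => by split_ifs <;> simp [hq]
  have hle : ∀ k i, q i ≤ μ k (i k) := fun k i => by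
    rw [hμ]
    refine le_trans (by simp) (Finset.single_le_sum (f := fun i' => if i' k = i k then q i' else 0)
      (fun i' _ => by split_ifs <;> simp [hq]) (Finset.mem_univ i))
  have hμ1 : ∀ k, ∑ j, μ k j = 1 := fun k => by
    simp only [hμ]
    rw [Finset.sum_comm]
    simpa using hq1
  have hcross : ∀ k, ∑ j, negMulLogb (μ k j) =
      ∑ i, -(q i * Real.logb 2 (μ k (i k))) := fun k => by
    have : ∀ j, negMulLogb (μ k j) =
        ∑ i, if i k = j then -(q i * Real.logb 2 (μ k (i k))) else 0 := fun j => by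
      rw [negMulLogb]
      conv_lhs => rw [hμ k j, Finset.sum_mul, ← Finset.sum_neg_distrib, ← hμ k j]
      refine Finset.sum_congr rfl fun i _ => ?_
      split_ifs with h
      · rw [h]
      · simp
    simp only [this]
    rw [Finset.sum_comm]
    simp
  simp only [hcross]
  rw [Finset.sum_comm]
  have hterm : ∀ i, q i * ∑ k, Real.log (μ k (i k)) - q i * Real.log (q i) ≤
      (∏ k, μ k (i k)) - q i := fun i => by
    by_cases h0 : q i = 0
    · simpa [h0] using Finset.prod_nonneg fun k _ => hμ0 k (i k)
    have hpos : ∀ k, μ k (i k) ≠ 0 := fun k =>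
      ((lt_of_le_of_ne (hq i) (Ne.symm h0)).trans_le (hle k i)).ne'
    rw [← Real.log_prod (fun k _ => hpos k)]
    exact mul_log_sub_le (hq i) (Finset.prod_nonneg fun k _ => hμ0 k (i k))
      fun h => absurd h (Finset.prod_ne_zero_iff.2 fun k _ => hpos k)
  have hsum : ∑ i : ∀ k, n k, ((∏ k, μ k (i k)) - q i) = 0 := by
    rw [Finset.sum_sub_distrib, hq1, ← Fintype.prod_sum]
    simp [hμ1]
  have htot := Finset.sum_le_sum fun i (_ : i ∈ Finset.univ) => hterm i
  rw [hsum, Finset.sum_sub_distrib] at htot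
  have hlog : 0 ≤ (Real.log 2)⁻¹ := inv_nonneg.2 (Real.log_nonneg one_le_two)
  have hL : ∑ i, negMulLogb (q i) = (Real.log 2)⁻¹ * -∑ i, q i * Real.log (q i) := by
    rw [← Finset.sum_neg_distrib, Finset.mul_sum]
    refine Finset.sum_congr rfl fun i _ => ?_
    rw [negMulLogb, Real.logb]; ring
  have hR : ∑ i, ∑ k, -(q i * Real.logb 2 (μ k (i k))) =
      (Real.log 2)⁻¹ * -∑ i, q i * ∑ k, Real.log (μ k (i k)) := by
    rw [← Finset.sum_neg_distrib, Finset.mul_sum]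
    refine Finset.sum_congr rfl fun i _ => ?_
    rw [Finset.mul_sum, ← Finset.sum_neg_distrib, Finset.mul_sum]
    refine Finset.sum_congr rfl fun k _ => ?_
    rw [Real.logb]; ring
  rw [hL, hR]
  exact mul_le_mul_of_nonneg_left (by linarith) hlog

theorem sum_ite_prod_eq (t : ∀ k, n k → ℝ) (ht : ∀ k, ∑ j, t k j = 1) (k : κ) (j : n k) :
    ∑ i : ∀ k, n k, (if i k = j then ∏ l, t l (i l) else 0) = t k j := by
  have h : ∀ i : ∀ k, n k, (if i k = j then ∏ l, t l (i l) else 0) =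
      ∏ l, (Function.update t k fun i => if i = j then t k i else 0) l (i l) := by
    intro i
    have h0 : ∏ l ∈ Finset.univ.erase k,
        Function.update t k (fun i => if i = j then t k i else 0) l (i l) =
          ∏ l ∈ Finset.univ.erase k, t l (i l) :=
      Finset.prod_congr rfl fun l hl => by
        rw [Function.update_of_ne (Finset.ne_of_mem_erase hl)]
    rw [← Finset.mul_prod_erase _ _ (Finset.mem_univ k),
      ← Finset.mul_prod_erase _ _ (Finset.mem_univ k), Function.update_self, h0]
    split_ifs <;> simp
  simp only [h]
  rw [← Fintype.prod_sum, ← Finset.mul_prod_erase _ _ (Finset.mem_univ k), Finset.prod_eq_one]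
  · simp
  · intro l hl
    rw [← ht l]
    exact Finset.sum_congr rfl fun i _ => by
      rw [Function.update_of_ne (Finset.ne_of_mem_erase hl)]

end Classical

section PiKron

variable {κ : Type*} [Fintype κ] {n : κ → Type*}

/-- The tensor product of a family of matrices. -/
def piKron (A : ∀ k, Matrix (n k) (n k) ℂ) :
    Matrix (∀ k, n k) (∀ k, n k) ℂ :=
  Matrix.of fun p q => ∏ k, A k (p k) (q k)

theorem piKron_apply (A : ∀ k, Matrix (n k) (n k) ℂ) (p q : ∀ k, n k) :
    piKron A p q = ∏ k, A k (p k) (q k) := rfl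

theorem piKron_mul [DecidableEq κ] [∀ k, Fintype (n k)]
    (A B : ∀ k, Matrix (n k) (n k) ℂ) :
    piKron A * piKron B = piKron (fun k => A k * B k) := by
  ext p q
  simp only [mul_apply, piKron_apply, ← Finset.prod_mul_distrib]
  exact (Fintype.prod_sum fun k j => A k (p k) j * B k j (q k)).symm

theorem piKron_diagonal [∀ k, DecidableEq (n k)] (a : ∀ k, n k → ℂ) :
    piKron (fun k => diagonal (a k)) = diagonal (fun p => ∏ k, a k (p k)) := by
  ext p q
  rw [piKron_apply, diagonal_apply]
  split_ifs with h
  · subst h; simp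
  · obtain ⟨k, hk⟩ := Function.ne_iff.1 h
    exact Finset.prod_eq_zero (Finset.mem_univ k) (diagonal_apply_ne _ hk)

theorem piKron_one [∀ k, DecidableEq (n k)] : piKron (fun k => (1 : Matrix (n k) (n k) ℂ)) = 1 := by
  have h := piKron_diagonal (n := n) (fun _ _ => 1)
  simpa using h

theorem piKron_star (A : ∀ k, Matrix (n k) (n k) ℂ) :
    piKron (fun k => star (A k)) = star (piKron A) := by
  ext p q
  simp [piKron_apply, star_apply]

theorem trace_piKron [DecidableEq κ] [∀ k, Fintype (n k)]
    (A : ∀ k, Matrix (n k) (n k) ℂ) :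
    (piKron A).trace = ∏ k, (A k).trace := by
  simp only [trace, diag_apply, piKron_apply]
  exact (Fintype.prod_sum fun k j => A k j j).symm

theorem piKron_single [∀ k, DecidableEq (n k)] (p q : ∀ k, n k) :
    piKron (fun k => single (p k) (q k) (1 : ℂ)) = single p q 1 := by
  ext p' q'
  simp only [piKron_apply, single_apply]
  rw [Finset.prod_ite_zero]
  simp [funext_iff, forall_and]

theorem sum_negMulLogb_prod [DecidableEq κ] [∀ k, Fintype (n k)]
    (a : ∀ k, n k → ℝ) (ha : ∀ k, ∑ j, a k j = 1) :
    ∑ p : ∀ k, n k, negMulLogb (∏ k, a k (p k)) = ∑ k, ∑ j, negMulLogb (a k j) := by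
  have hterm : ∀ p : ∀ k, n k, negMulLogb (∏ k, a k (p k)) =
      ∑ k, ∏ l, if l = k then negMulLogb (a l (p l)) else a l (p l) := fun p => by
    by_cases h0 : ∏ k, a k (p k) = 0
    · obtain ⟨l, -, hl⟩ := Finset.prod_eq_zero_iff.1 h0
      rw [h0, Finset.sum_eq_zero]
      · simp [negMulLogb]
      intro k _
      refine Finset.prod_eq_zero (Finset.mem_univ l) ?_
      split_ifs <;> simp [hl, negMulLogb]
    rw [negMulLogb, Real.logb, Real.log_prod fun k hk => Finset.prod_ne_zero_iff.1 h0 k hk,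
      Finset.sum_div, Finset.mul_sum, ← Finset.sum_neg_distrib]
    refine Finset.sum_congr rfl fun k _ => ?_
    rw [← Finset.mul_prod_erase _ _ (Finset.mem_univ k),
      ← Finset.mul_prod_erase _ _ (Finset.mem_univ k), if_pos rfl]
    rw [Finset.prod_congr rfl fun l hl => if_neg (Finset.ne_of_mem_erase hl)]
    rw [negMulLogb, Real.logb]
    ring
  simp only [hterm]
  rw [Finset.sum_comm]
  refine Finset.sum_congr rfl fun k _ => ?_
  rw [← Fintype.prod_sum fun l j => if l = k then negMulLogb (a l j) else a l j,
    ← Finset.mul_prod_erase _ _ (Finset.mem_univ k)]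
  simp only [if_true]
  rw [Finset.prod_eq_one, mul_one]
  intro l hl
  simp [Finset.ne_of_mem_erase hl, ha]

variable [DecidableEq κ] [∀ k, DecidableEq (n k)]

theorem piKron_update_one_apply (k : κ) (y : Matrix (n k) (n k) ℂ) (p q : ∀ k, n k) :
    piKron (Function.update (fun _ => 1) k y) p q =
      if ∀ l, l ≠ k → p l = q l then y (p k) (q k) else 0 := by
  rw [piKron_apply, ← Finset.mul_prod_erase _ _ (Finset.mem_univ k), Function.update_self]
  have h : ∏ l ∈ Finset.univ.erase k, (Function.update (fun _ => 1) k y :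
      ∀ l, Matrix (n l) (n l) ℂ) l (p l) (q l) =
      ∏ l ∈ Finset.univ.erase k, if p l = q l then (1 : ℂ) else 0 :=
    Finset.prod_congr rfl fun l hl => by
      rw [Function.update_of_ne (Finset.ne_of_mem_erase hl), one_apply]
  rw [h, Finset.prod_ite_zero]
  simp

theorem piKron_update_one_one (k : κ) :
    piKron (Function.update (fun _ => 1) k (1 : Matrix (n k) (n k) ℂ)) = 1 := by
  rw [Function.update_eq_self_iff.2 rfl, piKron_one]

variable [∀ k, Fintype (n k)]

/-- The tensor product of unitary matrices. -/
def piKronUnitary (U : ∀ k, unitary (Matrix (n k) (n k) ℂ)) :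
    unitary (Matrix (∀ k, n k) (∀ k, n k) ℂ) :=
  ⟨piKron fun k => (U k : Matrix (n k) (n k) ℂ), by
    rw [Unitary.mem_iff, ← piKron_star, piKron_mul, piKron_mul]
    simp [piKron_one]⟩

theorem piKron_eq_conj_diagonal {A : ∀ k, Matrix (n k) (n k) ℂ} (hA : ∀ k, (A k).IsHermitian) :
    piKron A = (piKronUnitary fun k => (hA k).eigenvectorUnitary : Matrix _ _ ℂ) *
      diagonal (fun p => ((∏ k, (hA k).eigenvalues (p k) : ℝ) : ℂ)) *
      star (piKronUnitary fun k => (hA k).eigenvectorUnitary : Matrix _ _ ℂ) := by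
  have h := piKron_diagonal fun k j => ((hA k).eigenvalues j : ℂ)
  push_cast
  rw [piKronUnitary, ← h, ← piKron_star, piKron_mul, piKron_mul]
  exact congrArg piKron (funext fun k => (hA k).eq_conj_diagonal)

theorem piKron_posSemidef {A : ∀ k, Matrix (n k) (n k) ℂ} (hA : ∀ k, (A k).PosSemidef) :
    (piKron A).PosSemidef := by
  rw [piKron_eq_conj_diagonal fun k => (hA k).isHermitian]
  refine PosSemidef.mul_mul_conjTranspose_same (PosSemidef.diagonal fun p => ?_) _
  exact Complex.zero_le_real.2 (Finset.prod_nonneg fun k _ => (hA k).eigenvalues_nonneg (p k))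

theorem piKron_matState {A : ∀ k, Matrix (n k) (n k) ℂ} (hA : ∀ k, MatState (A k)) :
    MatState (piKron A) :=
  ⟨piKron_posSemidef fun k => (hA k).1, by simp [trace_piKron, (hA _).2]⟩

theorem traceEntropy_piKron {A : ∀ k, Matrix (n k) (n k) ℂ} (hA : ∀ k, MatState (A k)) :
    traceEntropy (piKron A) = ∑ k, traceEntropy (A k) := by
  have hH := fun k => (hA k).1.isHermitian
  rw [piKron_eq_conj_diagonal hH, traceEntropy_conj_diagonal,
    sum_negMulLogb_prod _ fun k => (hH k).sum_eigenvalues (hA k).2]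
  exact Finset.sum_congr rfl fun k _ => (traceEntropy_eq_sum_eigenvalues (hH k)).symm

/-- Tensoring with the identity in every factor but the `k`-th. -/
def slotHom (k : κ) : Matrix (n k) (n k) ℂ →⋆ₐ[ℂ] Matrix (∀ k, n k) (∀ k, n k) ℂ where
  toFun y := piKron (Function.update (fun _ => 1) k y)
  map_one' := piKron_update_one_one k
  map_mul' x y := by
    rw [piKron_mul]
    congr 1
    funext l
    rcases eq_or_ne l k with rfl | h
    · simp
    · simp [h]
  map_zero' := by
    ext p q
    simp [piKron_update_one_apply]
  map_add' x y := by
    ext p q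
    rw [Matrix.add_apply]
    simp only [piKron_update_one_apply]
    split_ifs <;> simp
  commutes' c := by
    have h := piKron_update_one_one (n := n) k
    rw [Algebra.algebraMap_eq_smul_one, Algebra.algebraMap_eq_smul_one, ← h]
    ext p q
    rw [Matrix.smul_apply]
    simp only [piKron_update_one_apply]
    split_ifs <;> simp
  map_star' x := by
    change piKron _ = star (piKron _)
    rw [← piKron_star]
    congr 1
    funext l
    rcases eq_or_ne l k with rfl | h
    · simp
    · simp [h]

theorem slotHom_eq_piKron (k : κ) (y : Matrix (n k) (n k) ℂ) :
    slotHom k y = piKron (Function.update (fun _ => 1) k y) := rfl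

theorem slotHom_apply (k : κ) (y : Matrix (n k) (n k) ℂ) (p q : ∀ k, n k) :
    slotHom k y p q = if ∀ l, l ≠ k → p l = q l then y (p k) (q k) else 0 :=
  piKron_update_one_apply k y p q

theorem slotHom_injective [∀ k, Nonempty (n k)] (k : κ) :
    Function.Injective (slotHom (n := n) k) := by
  intro x y h
  obtain ⟨p⟩ : Nonempty (∀ k, n k) := inferInstance
  ext i j
  have h' := congrFun (congrFun h (Function.update p k i)) (Function.update p k j)
  have hp : ∀ l, l ≠ k → Function.update p k i l = Function.update p k j l := fun l hl => by
    simp [hl]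
  rw [slotHom_apply, slotHom_apply, if_pos hp, if_pos hp] at h'
  simpa using h'

theorem trace_piKron_mul_slotHom {A : ∀ k, Matrix (n k) (n k) ℂ} (hA : ∀ k, (A k).trace = 1)
    (k : κ) (y : Matrix (n k) (n k) ℂ) :
    (piKron A * slotHom k y).trace = (A k * y).trace := by
  rw [slotHom_eq_piKron, piKron_mul, trace_piKron, ← Finset.mul_prod_erase _ _ (Finset.mem_univ k),
    Function.update_self, Finset.prod_eq_one, mul_one]
  intro l hl
  rw [Function.update_of_ne (Finset.ne_of_mem_erase hl), Matrix.mul_one, hA]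

end PiKron

section AlgebraEntropy

variable {α S D : Type*} [Fintype α] [DecidableEq α] [DecidableEq S] [Fintype D] [DecidableEq D]

theorem isMinProjOf_range (φ : (S → Matrix D D ℂ) →⋆ₐ[ℂ] Matrix α α ℂ)
    (hφ : Function.Injective φ) (s : S) (d : D) :
    IsMinProjOf φ.range (φ (Pi.single s (single d d 1))) := by
  refine ⟨⟨_, rfl⟩, ⟨?_, ?_⟩, ?_, ?_⟩
  · change star (φ _) = φ _
    rw [← map_star, ← Pi.single_star, star_eq_conjTranspose, conjTranspose_single, star_one]
  · rw [← map_mul, ← Pi.single_mul, single_mul_single_same, one_mul]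
  · rw [Ne, map_eq_zero_iff φ hφ, Pi.single_eq_zero_iff]
    intro h
    simpa using congrFun (congrFun h d) d
  · rintro _ ⟨C, rfl⟩ ⟨hC, hCC⟩ hCE
    change star (φ C) = φ C at hC
    change φ C * φ C = φ C at hCC
    change φ C * _ = φ C at hCE
    change φ C = 0 ∨ φ C = _
    rw [← map_star] at hC
    rw [← map_mul] at hCC hCE
    have hC := hφ hC
    have hCC := hφ hCC
    have hCE := hφ hCE
    have hne : ∀ t, t ≠ s → C t = 0 := fun t ht => by
      rw [← hCE]; simp [ht]
    have hs : C s * single d d 1 = C s := by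
      have := congrFun hCE s
      simpa using this
    have hss : star (C s) = C s := congrFun hC s
    have hs' : single d d 1 * C s = C s := by
      have := congrArg star hs
      rwa [star_mul, hss, star_eq_conjTranspose, conjTranspose_single, star_one] at this
    have hc : C s = single d d (C s d d) := by
      conv_lhs => rw [← hs, ← hs', single_mul_mul_single, one_mul, mul_one]
    have hcc : C s d d * C s d d = C s d d := by
      have := congrFun (congrFun (congrFun hCC s) d) d
      rw [Pi.mul_apply, hc] at this
      simpa using this
    have hCs : C = Pi.single s (single d d (C s d d)) := by
      funext t
      rcases eq_or_ne t s with rfl | ht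
      · rw [← hc, Pi.single_eq_same]
      · rw [hne t ht, Pi.single_eq_of_ne ht]
    have h01 : C s d d = 0 ∨ C s d d = 1 := by
      rcases eq_or_ne (C s d d) 0 with h | h
      · exact Or.inl h
      · exact Or.inr (mul_left_cancel₀ h (by rw [hcc, mul_one]))
    rcases h01 with h | h
    · left; rw [hCs, h]; simp
    · right; rw [hCs, h]

variable [Fintype S]

theorem eq_sum_single (C : S → Matrix D D ℂ) :
    C = ∑ s, ∑ d, ∑ d', C s d d' • Pi.single s (single d d' 1) := by
  conv_lhs => rw [← Finset.univ_sum_single C]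
  refine Finset.sum_congr rfl fun s _ => ?_
  conv_lhs => rw [matrix_eq_sum_single (C s)]
  funext t
  rcases eq_or_ne t s with rfl | ht
  · simp [Finset.sum_apply, smul_single]
  · simp [Finset.sum_apply, ht]

theorem canonicalTrace_apply (φ : (S → Matrix D D ℂ) →⋆ₐ[ℂ] Matrix α α ℂ)
    (hφ : Function.Injective φ) {τ : Matrix α α ℂ →ₗ[ℂ] ℂ} (hτ : IsCanonicalTrace φ.range τ)
    (C : S → Matrix D D ℂ) : τ (φ C) = ∑ s, (C s).trace := by
  have hunit : ∀ s d d', τ (φ (Pi.single s (single d d' 1))) = if d = d' then 1 else 0 := by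
    intro s d d'
    split_ifs with h
    · subst h; exact hτ.2.2 _ (isMinProjOf_range φ hφ s d)
    · have h1 := hτ.1 (φ (Pi.single s (single d d 1))) ⟨_, rfl⟩
        (φ (Pi.single s (single d d' 1))) ⟨_, rfl⟩
      rw [← map_mul, ← map_mul, ← Pi.single_mul, ← Pi.single_mul, single_mul_single_same,
        single_mul_single_of_ne _ _ _ _ (Ne.symm h), one_mul] at h1
      simpa using h1
  conv_lhs => rw [eq_sum_single C]
  simp only [map_sum, map_smul, hunit]
  simp [trace]

/-- The entropy of the algebra `φ.range` is the sum of the entropies of the blocks of the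
restricted state. -/
theorem IsAlgEntropy.eq_sum_traceEntropy (φ : (S → Matrix D D ℂ) →⋆ₐ[ℂ] Matrix α α ℂ)
    (hφ : Function.Injective φ) {ρ : Matrix α α ℂ} {R : S → Matrix D D ℂ}
    (hR : ∀ C, (ρ * φ C).trace = ∑ s, (R s * C s).trace) {H : ℝ}
    (h : IsAlgEntropy φ.range ρ H) : H = ∑ s, traceEntropy (R s) := by
  obtain ⟨τ, _, hτ, ⟨⟨B, rfl⟩, hpos, hres⟩, rfl⟩ := h
  change PosSemidef (φ B) at hpos
  change ∀ x ∈ _, τ (φ B * x) = _ at hres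
  change algEntropy τ (φ B) = _
  have hBR : B = R := by
    funext s
    ext d d'
    have h1 := hres (φ (Pi.single s (single d' d 1))) ⟨_, rfl⟩
    have hsum : ∀ A : S → Matrix D D ℂ,
        ∑ t, (A t * (Pi.single s (single d' d 1) : S → Matrix D D ℂ) t).trace = A s d d' := by
      intro A
      rw [Finset.sum_eq_single s (fun t _ ht => by simp [ht]) (by simp), Pi.single_eq_same,
        trace_mul_single]
      simp
    rw [← map_mul, canonicalTrace_apply φ hφ hτ, hR, hsum] at h1
    rw [← h1]
    exact (hsum B).symm
  have hH : ∀ s, (B s).IsHermitian := by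
    have h1 : star (φ B) = φ B := hpos.isHermitian
    rw [← map_star] at h1
    exact fun s => congrFun (hφ h1) s
  obtain ⟨p, hp⟩ := exists_polynomial_eval_eq_logb
    (Finset.univ.image hpos.isHermitian.eigenvalues ∪
      Finset.univ.biUnion fun s => Finset.univ.image (hH s).eigenvalues)
  have hlogB : ∀ s, matLogb (B s) = Polynomial.aeval (B s) p := fun s =>
    matLogb_eq_aeval (hH s) p fun i => hp _ (by
      refine Finset.mem_union_right _ (Finset.mem_biUnion.2 ⟨s, Finset.mem_univ _, ?_⟩)
      exact Finset.mem_image_of_mem _ (Finset.mem_univ i))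
  have hlog : matLogb (φ B) = φ (Polynomial.aeval B p) := by
    rw [matLogb_eq_aeval hpos.isHermitian p fun i => hp _ (by simp)]
    exact Polynomial.aeval_algHom_apply φ B p
  rw [algEntropy, hlog, ← map_mul, canonicalTrace_apply φ hφ hτ, Complex.re_sum,
    ← Finset.sum_neg_distrib, ← hBR]
  refine Finset.sum_congr rfl fun s _ => ?_
  rw [traceEntropy, hlogB, Pi.mul_apply, Polynomial.aeval_pi_apply₂]

end AlgebraEntropy

section BlockAlgebras

variable {ι S D D' : Type*} [Fintype ι] [DecidableEq ι] [Fintype D]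
  [DecidableEq D] [Fintype D'] [DecidableEq D']

/-- The inclusion of block diagonal matrices. -/
def blockHom : (ι → Matrix D D ℂ) →⋆ₐ[ℂ] Matrix (ι × D) (ι × D) ℂ where
  toFun M := Matrix.of fun p q => if p.1 = q.1 then M p.1 p.2 q.2 else 0
  map_one' := by
    ext ⟨x, d⟩ ⟨y, e⟩
    simp [one_apply, ite_and]
  map_mul' M N := by
    ext ⟨x, d⟩ ⟨y, e⟩
    rw [mul_apply, Fintype.sum_prod_type]
    by_cases h : x = y
    · subst h; simp [mul_apply]
    · simp [h]
  map_zero' := by ext; simp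
  map_add' M N := by
    ext p q
    simp only [of_apply, Matrix.add_apply, Pi.add_apply]
    split_ifs <;> simp
  commutes' c := by
    ext ⟨x, d⟩ ⟨y, e⟩
    simp [algebraMap_matrix_apply, ite_and]
  map_star' M := by
    ext ⟨x, d⟩ ⟨y, e⟩
    by_cases h : x = y
    · subst h; simp [star_apply]
    · simp [h, Ne.symm h, star_apply]

theorem blockHom_apply (M : ι → Matrix D D ℂ) (p q : ι × D) :
    blockHom M p q = if p.1 = q.1 then M p.1 p.2 q.2 else 0 := rfl

theorem blockHom_injective : Function.Injective (blockHom (ι := ι) (D := D)) := by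
  intro M N h
  funext x
  ext d e
  simpa [blockHom_apply] using congrFun (congrFun h (x, d)) (x, e)

theorem trace_blockHom (M : ι → Matrix D D ℂ) : (blockHom M).trace = ∑ x, (M x).trace := by
  simp [trace, Fintype.sum_prod_type, blockHom_apply]

/-- The block diagonal matrices whose block at `x` is the image under `h` of the block of `C` at
`g x`. -/
def pullHom (g : ι → S) (h : Matrix D D ℂ →⋆ₐ[ℂ] Matrix D' D' ℂ) :
    (S → Matrix D D ℂ) →⋆ₐ[ℂ] Matrix (ι × D') (ι × D') ℂ :=
  blockHom.comp
    { toFun := fun C x => h (C (g x))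
      map_one' := by funext; simp
      map_mul' := fun _ _ => by funext; simp
      map_zero' := by funext; simp
      map_add' := fun _ _ => by funext; simp
      commutes' := fun c => funext fun _ => AlgHomClass.commutes h c
      map_star' := fun _ => by funext; simp [map_star] }

theorem pullHom_apply (g : ι → S) (h : Matrix D D ℂ →⋆ₐ[ℂ] Matrix D' D' ℂ)
    (C : S → Matrix D D ℂ) : pullHom g h C = blockHom fun x => h (C (g x)) := rfl

theorem pullHom_injective {g : ι → S} (hg : Function.Surjective g)
    {h : Matrix D D ℂ →⋆ₐ[ℂ] Matrix D' D' ℂ} (hh : Function.Injective h) :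
    Function.Injective (pullHom g h) := by
  intro B C hBC
  have h1 := blockHom_injective hBC
  funext s
  obtain ⟨x, rfl⟩ := hg s
  exact hh (congrFun h1 x)

/-- The scalar matrices. -/
def scalarHom (E : Type*) [Fintype E] [DecidableEq E] :
    Matrix Unit Unit ℂ →⋆ₐ[ℂ] Matrix E E ℂ where
  toFun c := c () () • 1
  map_one' := by simp
  map_mul' a b := by simp [mul_apply, smul_smul, mul_comm]
  map_zero' := by simp
  map_add' a b := by simp [add_smul]
  commutes' c := by simp [algebraMap_matrix_apply, Algebra.algebraMap_eq_smul_one]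
  map_star' a := by simp [star_apply]

theorem scalarHom_apply (c : Matrix Unit Unit ℂ) : scalarHom D c = c () () • 1 := rfl

theorem scalarHom_injective [Nonempty D] : Function.Injective (scalarHom D) := by
  intro a b h
  obtain ⟨d⟩ := ‹Nonempty D›
  ext ⟨⟩ ⟨⟩
  simpa [scalarHom_apply] using congrFun (congrFun h d) d

/-- The entropy of the algebra `(pullHom g h).range` in the block diagonal state with blocks
`P x • w x`. -/
theorem IsAlgEntropy.eq_sum_of_pullHom [Fintype S] [DecidableEq S] {g : ι → S}
    (hg : Function.Surjective g) {h : Matrix D D ℂ →⋆ₐ[ℂ] Matrix D' D' ℂ}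
    (hh : Function.Injective h) {P : ι → ℝ} {w : ι → Matrix D' D' ℂ} {v : ι → Matrix D D ℂ}
    (hv : ∀ x c, (w x * h c).trace = (v x * c).trace) {H : ℝ}
    (hH : IsAlgEntropy (pullHom g h).range (blockHom fun x => (P x : ℂ) • w x) H) :
    H = ∑ s, traceEntropy (∑ x, if g x = s then (P x : ℂ) • v x else 0) := by
  refine hH.eq_sum_traceEntropy (pullHom g h) (pullHom_injective hg hh) fun C => ?_
  rw [pullHom_apply, ← map_mul, trace_blockHom]
  simp only [Pi.mul_apply, Matrix.sum_mul, trace_sum]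
  rw [Finset.sum_comm]
  refine Finset.sum_congr rfl fun x _ => ?_
  rw [Finset.sum_eq_single (g x) (fun s _ hs => by simp [hs.symm]) (by simp), if_pos rfl,
    Matrix.smul_mul, Matrix.smul_mul, trace_smul, trace_smul, hv]

theorem pullHom_range_mono {S₁ D₁ : Type*} [Fintype D₁] [DecidableEq D₁] {g : ι → S}
    {h : Matrix D D ℂ →⋆ₐ[ℂ] Matrix D' D' ℂ} {g₁ : ι → S₁}
    {h₁ : Matrix D₁ D₁ ℂ →⋆ₐ[ℂ] Matrix D' D' ℂ}
    (f : (S₁ → Matrix D₁ D₁ ℂ) → S → Matrix D D ℂ)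
    (hf : ∀ C x, h (f C (g x)) = h₁ (C (g₁ x))) : (pullHom g₁ h₁).range ≤ (pullHom g h).range := by
  rintro _ ⟨C, rfl⟩
  exact ⟨f C, congrArg blockHom (funext fun x => hf C x)⟩

/-- The classical part and the quantum part generate the classical-quantum algebra. -/
theorem pullHom_scalarHom_sup [Fintype S] [DecidableEq S] (g : ι → S)
    (h : Matrix D D ℂ →⋆ₐ[ℂ] Matrix D' D' ℂ) :
    (pullHom g (scalarHom D')).range ⊔ (pullHom (fun _ : ι => ()) h).range =
      (pullHom g h).range := by
  apply le_antisymm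
  · refine sup_le (pullHom_range_mono (fun C s => C s () () • 1) fun C x => ?_)
      (pullHom_range_mono (fun C _ => C ()) fun C x => rfl)
    rw [map_smul, map_one, scalarHom_apply]
  · rintro _ ⟨C, rfl⟩
    change pullHom g h C ∈ _
    rw [← Finset.univ_sum_single C, map_sum]
    refine sum_mem fun s _ => ?_
    have hmul : pullHom g h (Pi.single s (C s)) =
        pullHom g (scalarHom D') (Pi.single s 1) * pullHom (fun _ : ι => ()) h fun _ => C s := by
      rw [pullHom_apply, pullHom_apply, pullHom_apply, ← map_mul]
      congr 1
      funext x
      rcases eq_or_ne (g x) s with hx | hx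
      · simp [hx]
      · simp [hx]
    rw [hmul]
    exact mul_mem (SetLike.le_def.1 le_sup_left ⟨_, rfl⟩) (SetLike.le_def.1 le_sup_right ⟨_, rfl⟩)

end BlockAlgebras

theorem classicalFactor_eq_range (k : Fin nn) :
    classicalFactor 𝒳 m k =
      (pullHom (fun x : ∀ k, 𝒳 k => x k) (scalarHom (∀ k, Fin (m k)))).range := by
  have h : {A | ∃ d : 𝒳 k → ℂ, A = Matrix.diagonal
      (fun p : (∀ k, 𝒳 k) × (∀ k, Fin (m k)) => d (p.1 k))} =
      ((pullHom (fun x : ∀ k, 𝒳 k => x k) (scalarHom (∀ k, Fin (m k)))).range : Set _) := by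
    have hd : ∀ C : 𝒳 k → Matrix Unit Unit ℂ,
        pullHom (fun x : ∀ k, 𝒳 k => x k) (scalarHom (∀ k, Fin (m k))) C =
          Matrix.diagonal (fun p => C (p.1 k) () ()) := by
      intro C
      ext p q
      simp only [pullHom_apply, blockHom_apply, scalarHom_apply, Matrix.smul_apply, one_apply,
        diagonal_apply, Prod.ext_iff, ite_and]
      split_ifs <;> simp
    ext A
    constructor
    · rintro ⟨d, rfl⟩
      exact ⟨fun x => Matrix.of fun _ _ => d x, hd _⟩
    · rintro ⟨C, rfl⟩
      exact ⟨fun x => C x () (), hd C⟩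
  rw [classicalFactor, h, StarAlgebra.adjoin_eq]

theorem quantumFactor_eq_range (k : Fin nn) :
    quantumFactor 𝒳 m k = (pullHom (fun _ : ∀ k, 𝒳 k => ()) (slotHom k)).range := by
  have h : {A | ∃ y : Matrix (Fin (m k)) (Fin (m k)) ℂ,
      A = Matrix.of fun p q : (∀ k, 𝒳 k) × (∀ k, Fin (m k)) =>
        if p.1 = q.1 ∧ ∀ l, l ≠ k → p.2 l = q.2 l then y (p.2 k) (q.2 k) else 0} =
      ((pullHom (fun _ : ∀ k, 𝒳 k => ()) (slotHom (n := fun k => Fin (m k)) k)).range :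
        Set _) := by
    have hd : ∀ C : Unit → Matrix (Fin (m k)) (Fin (m k)) ℂ,
        pullHom (fun _ : ∀ k, 𝒳 k => ()) (slotHom (n := fun k => Fin (m k)) k) C =
          Matrix.of fun p q =>
            if p.1 = q.1 ∧ ∀ l, l ≠ k → p.2 l = q.2 l then C () (p.2 k) (q.2 k) else 0 := by
      intro C
      ext p q
      simp only [pullHom_apply, blockHom_apply, slotHom_apply, of_apply, ite_and]
      split_ifs <;> rfl
    ext A
    constructor
    · rintro ⟨y, rfl⟩
      exact ⟨fun _ => y, hd _⟩
    · rintro ⟨C, rfl⟩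
      exact ⟨C (), hd C⟩
  rw [quantumFactor, h, StarAlgebra.adjoin_eq]

theorem iSup_classicalFactor :
    ⨆ k, classicalFactor 𝒳 m k =
      (pullHom (id : (∀ k, 𝒳 k) → _) (scalarHom (∀ k, Fin (m k)))).range := by
  apply le_antisymm
  · refine iSup_le fun k => ?_
    rw [classicalFactor_eq_range]
    exact pullHom_range_mono (fun C x => C (x k)) fun C x => rfl
  · rintro _ ⟨C, rfl⟩
    change pullHom _ _ C ∈ _
    have key : ∀ (x : ∀ k, 𝒳 k) (F : Finset (Fin nn)),
        pullHom (id : (∀ k, 𝒳 k) → _) (scalarHom (∀ k, Fin (m k)))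
          (fun y => if ∀ k ∈ F, y k = x k then 1 else 0) ∈ ⨆ k, classicalFactor 𝒳 m k := by
      intro x F
      induction F using Finset.induction_on with
      | empty =>
        simp only [Finset.notMem_empty, false_imp_iff, implies_true, if_true]
        change pullHom _ _ 1 ∈ _
        rw [map_one]
        exact one_mem _
      | insert k F _ ih =>
        have hk : pullHom (id : (∀ k, 𝒳 k) → _) (scalarHom (∀ k, Fin (m k)))
            (fun y => if y k = x k then 1 else 0) ∈ ⨆ k, classicalFactor 𝒳 m k := by
          refine SetLike.le_def.1 (le_iSup (fun k => classicalFactor 𝒳 m k) k) ?_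
          rw [classicalFactor_eq_range]
          exact ⟨fun y => if y = x k then 1 else 0, rfl⟩
        have hmul := mul_mem hk ih
        rw [← map_mul] at hmul
        convert hmul using 2
        funext y
        simp only [Finset.forall_mem_insert, Pi.mul_apply, ite_and]
        split_ifs <;> simp
    have hC : C = ∑ x, C x () () • fun y => if ∀ k ∈ Finset.univ, y k = x k then 1 else 0 := by
      funext y
      ext ⟨⟩ ⟨⟩
      rw [Finset.sum_apply, Matrix.sum_apply, Finset.sum_eq_single y]
      · simp
      · intro x _ hx
        have hne : ¬∀ k ∈ Finset.univ, y k = x k := fun h =>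
          hx (funext fun k => (h k (Finset.mem_univ k)).symm)
        rw [Pi.smul_apply, if_neg hne]
        simp
      · simp
    rw [hC, map_sum]
    refine sum_mem fun x _ => ?_
    rw [map_smul]
    exact SMulMemClass.smul_mem _ (key x _)

theorem iSup_quantumFactor :
    ⨆ k, quantumFactor 𝒳 m k =
      (pullHom (fun _ : ∀ k, 𝒳 k => ())
        (StarAlgHom.id ℂ (Matrix (∀ k, Fin (m k)) (∀ k, Fin (m k)) ℂ))).range := by
  apply le_antisymm
  · refine iSup_le fun k => ?_
    rw [quantumFactor_eq_range]
    exact pullHom_range_mono (fun C s => slotHom k (C s)) fun C x => rfl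
  · rintro _ ⟨C, rfl⟩
    change pullHom _ _ C ∈ _
    have key : ∀ (B : ∀ k, Matrix (Fin (m k)) (Fin (m k)) ℂ) (F : Finset (Fin nn)),
        pullHom (fun _ : ∀ k, 𝒳 k => ()) (StarAlgHom.id ℂ _)
          (fun _ => piKron fun k => if k ∈ F then B k else 1) ∈ ⨆ k, quantumFactor 𝒳 m k := by
      intro B F
      induction F using Finset.induction_on with
      | empty =>
        simp only [Finset.notMem_empty, if_false, piKron_one]
        change pullHom _ _ 1 ∈ _
        rw [map_one]
        exact one_mem _
      | insert k F hkF ih =>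
        have hk : pullHom (fun _ : ∀ k, 𝒳 k => ()) (StarAlgHom.id ℂ _)
            (fun _ => slotHom k (B k)) ∈ ⨆ k, quantumFactor 𝒳 m k := by
          refine SetLike.le_def.1 (le_iSup (fun k => quantumFactor 𝒳 m k) k) ?_
          rw [quantumFactor_eq_range]
          exact ⟨fun _ => B k, rfl⟩
        have hmul := mul_mem hk ih
        rw [← map_mul] at hmul
        convert hmul using 2
        funext _
        rw [Pi.mul_apply, slotHom_eq_piKron, piKron_mul]
        congr 1
        funext l
        rcases eq_or_ne l k with rfl | hl
        · simp [hkF]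
        · simp [hl]
    have hC : C = ∑ p, ∑ q, C () p q • fun _ => piKron fun k =>
        if k ∈ Finset.univ then single (p k) (q k) (1 : ℂ) else 1 := by
      funext _
      simp only [Finset.mem_univ, if_true, piKron_single]
      conv_lhs => rw [matrix_eq_sum_single (C _)]
      simp [Finset.sum_apply, smul_single]
    rw [hC, map_sum]
    refine sum_mem fun p _ => ?_
    rw [map_sum]
    refine sum_mem fun q _ => ?_
    rw [map_smul]
    exact SMulMemClass.smul_mem _ (key (fun k => single (p k) (q k) 1) _)

theorem cqMultiState_eq_blockHom (P : (∀ k, 𝒳 k) → ℝ)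
    (W : ∀ k, 𝒳 k → Matrix (Fin (m k)) (Fin (m k)) ℂ) :
    cqMultiState P W = blockHom fun x => (P x : ℂ) • piKron fun k => W k (x k) := by
  ext p q
  simp [cqMultiState, blockHom_apply, piKron_apply]

/-- Subadditivity of the von Neumann entropy for mixtures of product states. -/
theorem traceEntropy_mixture_le {ι : Type*} [Fintype ι] {P : ι → ℝ} (hP : ∀ x, 0 ≤ P x)
    (hPsum : ∑ x, P x = 1) {A : ι → ∀ k, Matrix (Fin (m k)) (Fin (m k)) ℂ}
    (hA : ∀ x k, MatState (A x k)) :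
    traceEntropy (∑ x, (P x : ℂ) • piKron (A x)) ≤
      ∑ k, traceEntropy (∑ x, (P x : ℂ) • A x k) := by
  have hP' : ∀ x, 0 ≤ (P x : ℂ) := fun x => Complex.zero_le_real.2 (hP x)
  have hpos : ∀ k, (∑ x, (P x : ℂ) • A x k).PosSemidef := fun k =>
    posSemidef_sum _ fun x _ => (hA x k).1.smul (hP' x)
  have hposall : (∑ x, (P x : ℂ) • piKron (A x)).PosSemidef :=
    posSemidef_sum _ fun x _ => (piKron_posSemidef fun k => (hA x k).1).smul (hP' x)
  have hH := fun k => (hpos k).isHermitian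
  set U : ∀ k, unitary (Matrix (Fin (m k)) (Fin (m k)) ℂ) := fun k => (hH k).eigenvectorUnitary
  set T : ι → ∀ k, Matrix (Fin (m k)) (Fin (m k)) ℂ := fun x k =>
    star (U k).1 * A x k * (U k).1 with hT
  have hTstate : ∀ x k, MatState (T x k) := fun x k => by
    refine ⟨(hA x k).1.conjTranspose_mul_mul_same _, ?_⟩
    change (star (U k).1 * A x k * (U k).1).trace = 1
    rw [Matrix.mul_assoc, trace_mul_comm, Matrix.mul_assoc, Unitary.mul_star_self_of_mem (U k).2,
      Matrix.mul_one, (hA x k).2]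
  have hTnn : ∀ x k j, 0 ≤ (T x k j j).re := fun x k j =>
    (Complex.le_def.1 ((hTstate x k).1.diag_nonneg (i := j))).1
  have hTreal : ∀ x k j, T x k j j = ((T x k j j).re : ℂ) := fun x k j =>
    ((hTstate x k).1.isHermitian.coe_re_apply_self j).symm
  have hTsum : ∀ x k, ∑ j, (T x k j j).re = 1 := fun x k => by
    have h := congrArg Complex.re (hTstate x k).2
    simpa [trace, Complex.re_sum] using h
  set q : (∀ k, Fin (m k)) → ℝ := fun i => ∑ x, P x * ∏ k, (T x k (i k) (i k)).re with hq
  have hdiag : ∀ i, ((star (piKronUnitary U).1 * (∑ x, (P x : ℂ) • piKron (A x)) *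
      (piKronUnitary U).1) i i).re = q i := by
    intro i
    have h1 : star (piKronUnitary U).1 * (∑ x, (P x : ℂ) • piKron (A x)) *
        (piKronUnitary U).1 = ∑ x, (P x : ℂ) • piKron (T x) := by
      rw [Finset.mul_sum, Finset.sum_mul]
      refine Finset.sum_congr rfl fun x _ => ?_
      rw [Matrix.mul_smul, Matrix.smul_mul, piKronUnitary, ← piKron_star, piKron_mul, piKron_mul]
    rw [h1, Matrix.sum_apply, Complex.re_sum]
    refine Finset.sum_congr rfl fun x _ => ?_
    rw [Matrix.smul_apply, piKron_apply, Finset.prod_congr rfl fun k _ => hTreal x k (i k),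
      smul_eq_mul, ← Complex.ofReal_prod, ← Complex.ofReal_mul, Complex.ofReal_re]
  have hq0 : ∀ i, 0 ≤ q i := fun i =>
    Finset.sum_nonneg fun x _ => mul_nonneg (hP x) (Finset.prod_nonneg fun k _ => hTnn x k _)
  have hq1 : ∑ i, q i = 1 := by
    rw [hq, Finset.sum_comm]
    have h : ∀ x, ∑ i : ∀ k, Fin (m k), ∏ k, (T x k (i k) (i k)).re = 1 := fun x => by
      rw [← Fintype.prod_sum fun k j => (T x k j j).re]
      simp [hTsum]
    simp only [← Finset.mul_sum, h, mul_one, hPsum]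
  have hmarg : ∀ k j, (hH k).eigenvalues j = ∑ i, if i k = j then q i else 0 := by
    intro k j
    have h1 : (hH k).eigenvalues j = ∑ x, P x * (T x k j j).re := by
      have h2 : star (U k).1 * (∑ x, (P x : ℂ) • A x k) * (U k).1 =
          diagonal (fun i => ((hH k).eigenvalues i : ℂ)) := by
        conv_lhs => rw [(hH k).eq_conj_diagonal]
        have hUU : star (U k).1 * (U k).1 = 1 :=
          Unitary.star_mul_self_of_mem (U k).2
        rw [Matrix.mul_assoc, Matrix.mul_assoc, hUU, Matrix.mul_one, ← Matrix.mul_assoc, hUU,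
          Matrix.one_mul]
      have h3 := congrArg Complex.re (congrFun (congrFun h2 j) j)
      rw [diagonal_apply_eq, Complex.ofReal_re, Finset.mul_sum, Finset.sum_mul, Matrix.sum_apply,
        Complex.re_sum] at h3
      rw [← h3]
      refine Finset.sum_congr rfl fun x _ => ?_
      rw [Matrix.mul_smul, Matrix.smul_mul, Matrix.smul_apply, smul_eq_mul, Complex.re_ofReal_mul]
    rw [h1]
    have h6 : ∀ i : ∀ k, Fin (m k), (if i k = j then q i else 0) =
        ∑ x, P x * if i k = j then ∏ l, (T x l (i l) (i l)).re else 0 := by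
      intro i
      split_ifs
      · rfl
      · simp
    simp only [h6]
    rw [Finset.sum_comm]
    have h7 : ∀ x, ∑ i : ∀ k, Fin (m k), (if i k = j then ∏ l, (T x l (i l) (i l)).re else 0) =
        (T x k j j).re := fun x => sum_ite_prod_eq (fun l j => (T x l j j).re) (hTsum x) k j
    simp only [← Finset.mul_sum, h7]
  calc traceEntropy (∑ x, (P x : ℂ) • piKron (A x))
      ≤ ∑ i, negMulLogb (q i) :=
        (traceEntropy_le_diag hposall (piKronUnitary U)).trans_eq
          (Finset.sum_congr rfl fun i _ => congrArg negMulLogb (hdiag i))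
    _ ≤ ∑ k, ∑ j, negMulLogb ((hH k).eigenvalues j) :=
        sum_negMulLogb_le_sum_marginals q hq0 hq1 _ hmarg
    _ = _ := Finset.sum_congr rfl fun k _ => (traceEntropy_eq_sum_eigenvalues (hH k)).symm

/-- for the classical–quantum state `γ`,
`I_γ(𝔛₁⋯𝔛_n ∧ 𝔜₁⋯𝔜_n) ≤ ∑_k I_γ(𝔛_k ∧ 𝔜_k)`. -/
theorem cq_mutual_information_subadditive
    (P : (∀ k, 𝒳 k) → ℝ) (hP : ∀ x, 0 ≤ P x) (hPsum : ∑ x, P x = 1)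
    (W : ∀ k, 𝒳 k → Matrix (Fin (m k)) (Fin (m k)) ℂ)
    (hW : ∀ k x, MatState (W k x))
    (HXall HYall HXYall : ℝ)
    (hHXall : IsAlgEntropy (⨆ k, classicalFactor 𝒳 m k) (cqMultiState P W) HXall)
    (hHYall : IsAlgEntropy (⨆ k, quantumFactor 𝒳 m k) (cqMultiState P W) HYall)
    (hHXYall : IsAlgEntropy ((⨆ k, classicalFactor 𝒳 m k) ⊔ ⨆ k, quantumFactor 𝒳 m k)
      (cqMultiState P W) HXYall)
    (HX HY HXY : Fin nn → ℝ)
    (hHX : ∀ k, IsAlgEntropy (classicalFactor 𝒳 m k) (cqMultiState P W) (HX k))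
    (hHY : ∀ k, IsAlgEntropy (quantumFactor 𝒳 m k) (cqMultiState P W) (HY k))
    (hHXY : ∀ k, IsAlgEntropy (classicalFactor 𝒳 m k ⊔ quantumFactor 𝒳 m k)
      (cqMultiState P W) (HXY k)) :
    HXall + HYall - HXYall ≤ ∑ k, (HX k + HY k - HXY k) := by
  obtain ⟨x₀⟩ : Nonempty (∀ k, 𝒳 k) := by
    by_contra h
    rw [not_nonempty_iff] at h
    simp at hPsum
  have hm : ∀ k, Nonempty (Fin (m k)) := fun k => by
    by_contra h
    rw [not_nonempty_iff] at h
    simpa [trace] using (hW k (x₀ k)).2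
  have heval : ∀ k, Function.Surjective fun x : ∀ k, 𝒳 k => x k := fun k s =>
    ⟨Function.update x₀ k s, by simp⟩
  have hconst : Function.Surjective fun _ : ∀ k, 𝒳 k => () := fun _ => ⟨x₀, rfl⟩
  have hWx : ∀ (x : ∀ k, 𝒳 k) k, MatState (W k (x k)) := fun x k => hW k (x k)
  have htr : ∀ x : ∀ k, 𝒳 k, (piKron fun k => W k (x k)).trace = 1 := fun x =>
    (piKron_matState (hWx x)).2
  have hscalar : ∀ (x : ∀ k, 𝒳 k) (c : Matrix Unit Unit ℂ),
      ((piKron fun k => W k (x k)) * scalarHom (∀ k, Fin (m k)) c).trace =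
        ((1 : Matrix Unit Unit ℂ) * c).trace := fun x c => by
    rw [scalarHom_apply, Matrix.mul_smul, Matrix.mul_one, trace_smul, htr, Matrix.one_mul]
    simp [trace]
  have hslot : ∀ k (x : ∀ k, 𝒳 k) (y : Matrix (Fin (m k)) (Fin (m k)) ℂ),
      ((piKron fun k => W k (x k)) * slotHom k y).trace = (W k (x k) * y).trace := fun k x y =>
    trace_piKron_mul_slotHom (fun k => (hWx x k).2) k y
  have hid : Function.Injective
      (StarAlgHom.id ℂ (Matrix (∀ k, Fin (m k)) (∀ k, Fin (m k)) ℂ)) := fun _ _ h => h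
  simp only [classicalFactor_eq_range, quantumFactor_eq_range, pullHom_scalarHom_sup]
    at hHX hHY hHXY
  rw [iSup_classicalFactor] at hHXall hHXYall
  rw [iSup_quantumFactor] at hHYall hHXYall
  rw [pullHom_scalarHom_sup] at hHXYall
  rw [cqMultiState_eq_blockHom] at *
  set p : ∀ k, 𝒳 k → ℝ := fun k s => ∑ x : ∀ k, 𝒳 k, if x k = s then P x else 0 with hp
  have eXall : HXall = ∑ x, negMulLogb (P x) := by
    rw [hHXall.eq_sum_of_pullHom Function.surjective_id scalarHom_injective hscalar]
    refine Finset.sum_congr rfl fun x _ => ?_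
    rw [← traceEntropy_unit (P x)]
    simp
  have eYall : HYall = traceEntropy (∑ x, (P x : ℂ) • piKron fun k => W k (x k)) := by
    rw [hHYall.eq_sum_of_pullHom hconst hid (fun _ _ => rfl)]
    simp
  have eXYall : HXYall = ∑ x, (P x * ∑ k, traceEntropy (W k (x k)) + negMulLogb (P x)) := by
    rw [hHXYall.eq_sum_of_pullHom Function.surjective_id hid (fun _ _ => rfl)]
    refine Finset.sum_congr rfl fun x _ => ?_
    rw [← traceEntropy_piKron (hWx x), ← traceEntropy_smul_state (piKron_matState (hWx x))]
    simp
  have hblock : ∀ {D : Type} (k : Fin nn) (v : 𝒳 k → Matrix D D ℂ) (s : 𝒳 k),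
      ∑ x : ∀ k, 𝒳 k, (if x k = s then (P x : ℂ) • v (x k) else 0) = (p k s : ℂ) • v s := by
    intro D k v s
    rw [hp]
    push_cast
    rw [Finset.sum_smul]
    refine Finset.sum_congr rfl fun x _ => ?_
    split_ifs with h
    · rw [h]
    · simp
  have eX : ∀ k, HX k = ∑ s, negMulLogb (p k s) := fun k => by
    rw [(hHX k).eq_sum_of_pullHom (heval k) scalarHom_injective hscalar]
    refine Finset.sum_congr rfl fun s _ => ?_
    rw [hblock k (fun _ => 1), traceEntropy_unit]
  have eY : ∀ k, HY k = traceEntropy (∑ x : ∀ k, 𝒳 k, (P x : ℂ) • W k (x k)) := fun k => by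
    rw [(hHY k).eq_sum_of_pullHom hconst (slotHom_injective k) (hslot k)]
    simp
  have eXY : ∀ k, HXY k = ∑ s, (p k s * traceEntropy (W k s) + negMulLogb (p k s)) := fun k => by
    rw [(hHXY k).eq_sum_of_pullHom (heval k) (slotHom_injective k) (hslot k)]
    refine Finset.sum_congr rfl fun s _ => ?_
    rw [hblock k (W k), traceEntropy_smul_state (hW k s)]
  have hcond : ∑ x, P x * ∑ k, traceEntropy (W k (x k)) =
      ∑ k, ∑ s, p k s * traceEntropy (W k s) := by
    simp only [Finset.mul_sum]
    rw [Finset.sum_comm]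
    refine Finset.sum_congr rfl fun k _ => ?_
    simp only [hp, Finset.sum_mul]
    rw [Finset.sum_comm]
    simp
  have hsub := traceEntropy_mixture_le hP hPsum hWx
  rw [eXall, eXYall, eYall]
  simp only [eX, eY, eXY, Finset.sum_add_distrib, Finset.sum_sub_distrib]
  rw [hcond]
  linarith

end Statement14
end

section
/- Let 𝔛 and 𝔜 be compatible unital *-subalgebras of M_n(ℂ) and ρ a state on M_n(ℂ). Then I_ρ(𝔛∧𝔜) ≤ 2·min{H_ρ(𝔛), H_ρ(𝔜)}. -/
open scoped ComplexOrder Kronecker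
open Matrix

section FunctionalCalculus

variable {α : Type*} [Fintype α] [DecidableEq α]

theorem cfc_mem_adjoin {A : Matrix α α ℂ} (hA : A.IsHermitian) (f : ℝ → ℝ) :
    hA.cfc f ∈ Algebra.adjoin ℂ {A} := by
  set s : Finset ℝ := Finset.univ.image hA.eigenvalues
  set P : Polynomial ℂ := Lagrange.interpolate s (fun x : ℝ => (x : ℂ)) (fun x => (f x : ℂ))
  have hP (i : α) : P.eval (hA.eigenvalues i : ℂ) = f (hA.eigenvalues i) :=
    Lagrange.eval_interpolate_at_node (fun x : ℝ => (f x : ℂ)) (Complex.ofReal_injective.injOn)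
      (Finset.mem_image_of_mem _ (Finset.mem_univ i))
  let φ : (α → ℂ) →ₐ[ℂ] Matrix α α ℂ :=
    ((Unitary.conjStarAlgAut ℂ (Matrix α α ℂ) hA.eigenvectorUnitary).toAlgEquiv :
      Matrix α α ℂ →ₐ[ℂ] Matrix α α ℂ).comp
      (diagonalAlgHom ℂ)
  have hφ : φ (fun i => (hA.eigenvalues i : ℂ)) = A := hA.spectral_theorem.symm
  have hf : hA.cfc f = φ (fun i => (f (hA.eigenvalues i) : ℂ)) := rfl
  have hval : (fun i => (f (hA.eigenvalues i) : ℂ)) =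
      Polynomial.aeval (fun i => (hA.eigenvalues i : ℂ)) P := by
    funext i
    rw [← hP i, Polynomial.aeval_fn_apply]
    simp
  rw [hf, hval, ← Polynomial.aeval_algHom_apply, hφ]
  exact Polynomial.aeval_mem_adjoin_singleton ℂ A

theorem cfc_mul_of_mul_eq_smul {A : Matrix α α ℂ} (hA : A.IsHermitian) (f : ℝ → ℝ)
    {B : Matrix α α ℂ} {a : ℝ} (h : A * B = (a : ℂ) • B) :
    hA.cfc f * B = (f a : ℂ) • B := by
  set U : Matrix α α ℂ := (hA.eigenvectorUnitary : Matrix α α ℂ)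
  have hU : U * star U = 1 := Unitary.coe_mul_star_self _
  have hU' : star U * U = 1 := Unitary.coe_star_mul_self _
  have hA' : A = U * diagonal (fun i => (hA.eigenvalues i : ℂ)) * star U := hA.spectral_theorem
  have hf : hA.cfc f = U * diagonal (fun i => (f (hA.eigenvalues i) : ℂ)) * star U := rfl
  have h1 : diagonal (fun i => (hA.eigenvalues i : ℂ)) * (star U * B) = (a : ℂ) • (star U * B) := by
    calc _ = (star U * U) * (diagonal (fun i => (hA.eigenvalues i : ℂ)) * (star U * B)) := by
          rw [hU', one_mul]
      _ = star U * ((U * diagonal (fun i => (hA.eigenvalues i : ℂ)) * star U) * B) := by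
          simp only [mul_assoc]
      _ = _ := by rw [← hA', h, mul_smul_comm]
  have h2 : diagonal (fun i => (f (hA.eigenvalues i) : ℂ)) * (star U * B) =
      (f a : ℂ) • (star U * B) := by
    ext i j
    have := congrFun (congrFun h1 i) j
    simp only [diagonal_mul, Matrix.smul_apply, smul_eq_mul] at this ⊢
    rcases mul_eq_mul_right_iff.1 this with h | h
    · rw [Complex.ofReal_injective h]
    · simp [h]
  rw [hf, mul_assoc, mul_assoc, h2, mul_smul_comm, ← mul_assoc, hU, one_mul]

theorem matLogb_eq_cfc {A : Matrix α α ℂ} (hA : A.IsHermitian) :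
    matLogb A = hA.cfc (Real.logb 2) := by
  rw [matLogb, dif_pos hA]
  rfl

theorem cfc_indicator_isProjn {A : Matrix α α ℂ} (hA : A.IsHermitian) (a : ℝ) :
    IsProjn (hA.cfc (fun x => if x = a then 1 else 0)) := by
  constructor
  · rw [IsHermitian, IsHermitian.cfc, ← star_eq_conjTranspose, ← map_star]
    congr 1
    rw [star_eq_conjTranspose, diagonal_conjTranspose]
    congr 1
    ext i
    simp
  · rw [IsHermitian.cfc, ← map_mul, diagonal_mul_diagonal]
    congr 2
    ext i
    simp only [Function.comp_apply]
    split_ifs <;> simp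

theorem mul_cfc_indicator {A : Matrix α α ℂ} (hA : A.IsHermitian) (a : ℝ) :
    A * hA.cfc (fun x => if x = a then 1 else 0) =
      (a : ℂ) • hA.cfc (fun x => if x = a then 1 else 0) := by
  conv_lhs => enter [1]; rw [hA.spectral_theorem]
  rw [IsHermitian.cfc, ← map_mul, diagonal_mul_diagonal, ← map_smul]
  congr 1
  ext i j
  by_cases hij : i = j
  · subst hij
    by_cases h : hA.eigenvalues i = a <;> simp [h]
  · simp [diagonal_apply_ne _ hij]

end FunctionalCalculus

section Projections

variable {α : Type*} [Fintype α] [DecidableEq α]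

namespace IsProjn

variable {p q x : Matrix α α ℂ}

theorem mul_eq_of_mul_eq (hp : IsProjn p) (hq : IsProjn q) (h : p * q = p) : q * p = p := by
  have := congrArg conjTranspose h
  rwa [conjTranspose_mul, hp.1.eq, hq.1.eq] at this

theorem mul_of_commute (hp : IsProjn p) (hq : IsProjn q) (h : p * q = q * p) :
    IsProjn (p * q) := by
  refine ⟨?_, ?_⟩
  · rw [IsHermitian, conjTranspose_mul, hp.1.eq, hq.1.eq, h]
  · calc p * q * (p * q) = p * (q * p) * q := by simp only [mul_assoc]
      _ = p * p * (q * q) := by rw [← h]; simp only [mul_assoc]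
      _ = p * q := by rw [hp.2, hq.2]

theorem sub (hp : IsProjn p) (hq : IsProjn q) (h : p * q = p) : IsProjn (q - p) := by
  refine ⟨hq.1.sub hp.1, ?_⟩
  rw [sub_mul, mul_sub, mul_sub, hq.2, hp.2, h, hp.mul_eq_of_mul_eq hq h]
  abel

theorem eq_of_rank_le (hp : IsProjn p) (hq : IsProjn q) (h : p * q = p)
    (hr : q.rank ≤ p.rank) : p = q := by
  have hle : LinearMap.range p.mulVecLin ≤ LinearMap.range q.mulVecLin := by
    rintro _ ⟨v, rfl⟩
    refine ⟨p.mulVec v, ?_⟩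
    simp only [mulVecLin_apply, mulVec_mulVec, hp.mul_eq_of_mul_eq hq h]
  have heq := Submodule.eq_of_le_of_finrank_le hle hr
  rw [← h]
  apply Matrix.toLin'.injective
  ext1 i
  ext1
  simp only [LinearMap.comp_apply, toLin'_apply]
  have : q.mulVecLin (LinearMap.single ℂ (fun _ => ℂ) i 1) ∈ LinearMap.range p.mulVecLin :=
    heq ▸ LinearMap.mem_range_self _ _
  obtain ⟨v, hv⟩ := this
  simp only [mulVecLin_apply] at hv
  rw [← mulVec_mulVec, ← hv, mulVec_mulVec, hp.2]

end IsProjn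

theorem exists_cfc_indicator_mul_ne_zero {x e : Matrix α α ℂ} (hx : x.IsHermitian)
    (he : e ≠ 0) : ∃ a : ℝ, hx.cfc (fun t => if t = a then 1 else 0) * e ≠ 0 := by
  by_contra! hcon
  have hsum : ∑ a ∈ Finset.univ.image hx.eigenvalues,
      hx.cfc (fun t => if t = a then 1 else 0) = 1 := by
    simp only [IsHermitian.cfc]
    rw [← map_sum, ← map_one (Unitary.conjStarAlgAut ℂ (Matrix α α ℂ) hx.eigenvectorUnitary)]
    congr 1
    ext i j
    by_cases hij : i = j
    · subst hij
      simp [Matrix.sum_apply, apply_ite, Finset.sum_ite_eq]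
    · simp [Matrix.sum_apply, diagonal_apply_ne _ hij, one_apply_ne hij]
  apply he
  rw [← one_mul e, ← hsum, Finset.sum_mul]
  exact Finset.sum_eq_zero fun a _ => hcon a

variable {X : StarSubalgebra ℂ (Matrix α α ℂ)}

theorem exists_isMinProjOf_le {x e : Matrix α α ℂ} (hxX : x ∈ X) (hx : x.IsHermitian)
    (heX : e ∈ X) (he : IsProjn e) (he0 : e ≠ 0) (hex : e * x = x * e) :
    ∃ p, IsMinProjOf X p ∧ p * e = p ∧ ∃ a : ℝ, x * p = (a : ℂ) • p := by
  let S : Set (Matrix α α ℂ) := {q | q ∈ X ∧ IsProjn q ∧ q ≠ 0 ∧ q * e = q ∧ q * x = x * q}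
  obtain ⟨q, ⟨hqX, hq, hq0, hqe, hqx⟩, hmin⟩ :=
    exists_minimalFor_of_wellFoundedLT (· ∈ S) Matrix.rank ⟨e, heX, he, he0, he.2, hex⟩
  obtain ⟨a, ha⟩ := exists_cfc_indicator_mul_ne_zero hx hq0
  set F := hx.cfc (fun t => if t = a then 1 else 0) with hFdef
  have hFA : F ∈ Algebra.adjoin ℂ {x} := cfc_mem_adjoin hx _
  have hFX : F ∈ X := by
    have : Algebra.adjoin ℂ {x} ≤ X.toSubalgebra := Algebra.adjoin_le (by simpa using hxX)
    exact this hFA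
  have hFq : q * F = F * q := by
    have : Algebra.adjoin ℂ {x} ≤ Subalgebra.centralizer ℂ {q} :=
      Algebra.adjoin_le (by simpa [Set.mem_centralizer_iff] using hqx)
    exact (Subalgebra.mem_centralizer_iff ℂ).1 (this hFA) q rfl
  have hxF : x * F = (a : ℂ) • F := mul_cfc_indicator hx a
  have hF : IsProjn F := cfc_indicator_isProjn hx a
  have hFx : F * x = (a : ℂ) • F := by
    have := congrArg conjTranspose hxF
    simpa [conjTranspose_mul, hx.eq, hF.1.eq] using this
  have hFqP : IsProjn (F * q) := hF.mul_of_commute hq hFq.symm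
  have hFq_le : F * q * q = F * q := by rw [mul_assoc, hq.2]
  have hmem : F * q ∈ S := by
    refine ⟨mul_mem hFX hqX, hFqP, ha, by rw [mul_assoc, hqe], ?_⟩
    rw [mul_assoc, hqx, ← mul_assoc, ← mul_assoc, hFx, hxF]
  have heq : F * q = q :=
    hFqP.eq_of_rank_le hq hFq_le ((le_total _ _).elim id fun h => hmin hmem h)
  have hxq : x * q = (a : ℂ) • q := by
    conv_lhs => rw [← heq]
    rw [← mul_assoc, hxF, smul_mul_assoc, heq]
  refine ⟨q, ⟨hqX, hq, hq0, fun r hrX hr hrq => ?_⟩, hqe, a, hxq⟩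
  by_cases hr0 : r = 0
  · exact Or.inl hr0
  right
  have hqr := hr.mul_eq_of_mul_eq hq hrq
  have hxr : x * r = (a : ℂ) • r := by
    rw [← hqr, ← mul_assoc, hxq, smul_mul_assoc]
  have hrx : r * x = (a : ℂ) • r := by
    have := congrArg conjTranspose hxr
    simpa [conjTranspose_mul, hx.eq, hr.1.eq] using this
  have hmem' : r ∈ S := ⟨hrX, hr, hr0, by rw [← hrq, mul_assoc, hqe], by rw [hxr, hrx]⟩
  exact hr.eq_of_rank_le hq hrq ((le_total _ _).elim id fun h => hmin hmem' h)

namespace IsMinProjOf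

variable {p : Matrix α α ℂ}

theorem exists_smul_of_isHermitian (hp : IsMinProjOf X p) {y : Matrix α α ℂ} (hyX : y ∈ X)
    (hy : y.IsHermitian) : ∃ c : ℂ, p * y * p = c • p := by
  obtain ⟨hpX, hpP, hp0, hmin⟩ := hp
  have hx : (p * y * p).IsHermitian := by
    simp only [IsHermitian, conjTranspose_mul, hpP.1.eq, hy.eq, mul_assoc]
  obtain ⟨q, hq, hqp, a, ha⟩ := exists_isMinProjOf_le (mul_mem (mul_mem hpX hyX) hpX) hx
    hpX hpP hp0 (by rw [mul_assoc (p * y), hpP.2, ← mul_assoc, ← mul_assoc, hpP.2])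
  rcases hmin q hq.1 hq.2.1 hqp with h | h
  · exact absurd h hq.2.2.1
  · subst h
    exact ⟨a, by rwa [mul_assoc (q * y), hpP.2] at ha⟩

theorem exists_smul (hp : IsMinProjOf X p) {y : Matrix α α ℂ} (hyX : y ∈ X) :
    ∃ c : ℂ, p * y * p = c • p := by
  have hs : star y ∈ X := star_mem hyX
  obtain ⟨c, hc⟩ := hp.exists_smul_of_isHermitian (add_mem hyX hs)
    (isHermitian_add_transpose_self y)
  obtain ⟨d, hd⟩ := hp.exists_smul_of_isHermitian (y := Complex.I • (y - star y))
    (X.smul_mem (sub_mem hyX hs) _)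
    (by simp [IsHermitian, star_eq_conjTranspose, smul_sub, neg_add_eq_sub])
  refine ⟨(c - Complex.I * d) / 2, ?_⟩
  have h : y = (1 / 2 : ℂ) • ((y + star y) - Complex.I • (Complex.I • (y - star y))) := by
    rw [smul_smul, Complex.I_mul_I]
    module
  calc p * y * p
      = (1 / 2 : ℂ) • (p * (y + star y) * p
          - Complex.I • (p * (Complex.I • (y - star y)) * p)) := by
        conv_lhs => rw [h]
        simp only [mul_smul_comm, smul_mul_assoc, mul_sub, sub_mul]
    _ = _ := by rw [hc, hd]; module

end IsMinProjOf

theorem exists_isMinProjOf_decomposition_aux {x : Matrix α α ℂ} (hxX : x ∈ X)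
    (hx : x.IsHermitian) (k : ℕ) :
    ∀ e ∈ X, IsProjn e → e * x = x * e → e.rank ≤ k →
    ∃ (m : ℕ) (p : Fin m → Matrix α α ℂ) (a : Fin m → ℝ),
      (∀ i, IsMinProjOf X (p i)) ∧ ∑ i, p i = e ∧ ∀ i, x * p i = (a i : ℂ) • p i := by
  induction k with
  | zero =>
    intro e heX he hex hr
    have h0 : (0 : Matrix α α ℂ) = e :=
      IsProjn.eq_of_rank_le ⟨isHermitian_zero, by simp⟩ he (by simp) (by simpa using hr)
    exact ⟨0, Fin.elim0, Fin.elim0, fun i => i.elim0, by simpa using h0, fun i => i.elim0⟩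
  | succ k ih =>
    intro e heX he hex hr
    by_cases he0 : e = 0
    · exact ⟨0, Fin.elim0, Fin.elim0, fun i => i.elim0, by simp [he0], fun i => i.elim0⟩
    obtain ⟨q, hq, hqe, a, ha⟩ := exists_isMinProjOf_le hxX hx heX he he0 hex
    have hqx : q * x = x * q := by
      have := congrArg conjTranspose ha
      rw [conjTranspose_mul, hx.eq, hq.2.1.1.eq] at this
      rw [this, ha]
      simp [hq.2.1.1.eq]
    have hsub := hq.2.1.sub he hqe
    have hle : (e - q) * e = e - q := by rw [sub_mul, he.2, hqe]
    have hrank : (e - q).rank ≤ k := by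
      by_contra! hlt
      have := hsub.eq_of_rank_le he hle (by omega)
      exact hq.2.2.1 (by simpa using this)
    obtain ⟨m, p, b, hp, hsum, hb⟩ := ih (e - q) (sub_mem heX hq.1) hsub
      (by rw [sub_mul, mul_sub, hex, hqx]) hrank
    refine ⟨m + 1, Fin.cons q p, Fin.cons a b, ?_, ?_, ?_⟩
    · exact Fin.cases hq hp
    · rw [Fin.sum_univ_succ]
      simp [hsum]
    · exact Fin.cases ha hb

theorem exists_isMinProjOf_decomposition {x : Matrix α α ℂ} (hxX : x ∈ X)
    (hx : x.IsHermitian) :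
    ∃ (m : ℕ) (p : Fin m → Matrix α α ℂ) (a : Fin m → ℝ),
      (∀ i, IsMinProjOf X (p i)) ∧ ∑ i, p i = 1 ∧ ∀ i, x * p i = (a i : ℂ) • p i :=
  exists_isMinProjOf_decomposition_aux hxX hx _ 1 (one_mem X) ⟨isHermitian_one, mul_one 1⟩
    (by simp) le_rfl

end Projections

section ShannonInequalities

theorem mul_logb_sub_logb_le {m x y : ℝ} (hm : 0 ≤ m) (hx : 0 < m → 0 < x) (hy : 0 < m → 0 < y) :
    m * (Real.logb 2 x - Real.logb 2 y) ≤ m * (x / y - 1) / Real.log 2 := by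
  rcases hm.eq_or_lt with rfl | hm'
  · simp
  have hx := hx hm'
  have hy := hy hm'
  rw [← Real.logb_div hx.ne' hy.ne', Real.logb, ← mul_div_assoc]
  have := Real.log_le_sub_one_of_pos (div_pos hx hy)
  have h2 : 0 < Real.log 2 := Real.log_pos one_lt_two
  gcongr

theorem shannonEntropy_colSum_le_rowSum {A I : Type*} [Fintype A] [Fintype I] (M : A → I → ℝ)
    (hM : ∀ a i, 0 ≤ M a i) (hb : ∀ a, ∑ i, M a i / ∑ a', M a' i ≤ 1) :
    shannonEntropy (fun i => ∑ a, M a i) ≤ shannonEntropy (fun a => ∑ i, M a i) := by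
  have key (a : A) (i : I) := mul_logb_sub_logb_le (hM a i)
    (x := ∑ i', M a i') (y := ∑ a', M a' i)
    (fun h => h.trans_le (Finset.single_le_sum (fun i' _ => hM a i') (Finset.mem_univ i)))
    (fun h => h.trans_le
      (Finset.single_le_sum (f := fun a' => M a' i) (fun a' _ => hM a' i) (Finset.mem_univ a)))
  have hsum := Finset.sum_le_sum fun a (_ : a ∈ Finset.univ) =>
    Finset.sum_le_sum fun i (_ : i ∈ Finset.univ) => key a i
  have hL : ∑ a, ∑ i, M a i * (Real.logb 2 (∑ i', M a i') - Real.logb 2 (∑ a', M a' i)) =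
      shannonEntropy (fun i => ∑ a, M a i) - shannonEntropy (fun a => ∑ i, M a i) := by
    simp only [mul_sub, Finset.sum_sub_distrib, shannonEntropy, negMulLogb,
      Finset.sum_neg_distrib, Finset.sum_mul]
    rw [Finset.sum_comm (f := fun a i => M a i * Real.logb 2 (∑ a', M a' i))]
    ring
  have hR : ∑ a, ∑ i, M a i * ((∑ i', M a i') / (∑ a', M a' i) - 1) / Real.log 2 ≤ 0 := by
    simp only [← Finset.sum_div]
    refine div_nonpos_of_nonpos_of_nonneg ?_ (Real.log_nonneg one_le_two)
    refine Finset.sum_nonpos fun a _ => ?_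
    have : ∑ i, M a i * ((∑ i', M a i') / (∑ a', M a' i) - 1) =
        (∑ i', M a i') * (∑ i, M a i / ∑ a', M a' i) - ∑ i, M a i := by
      rw [Finset.mul_sum, ← Finset.sum_sub_distrib]
      exact Finset.sum_congr rfl fun i _ => by ring
    rw [this]
    have := mul_le_mul_of_nonneg_left (hb a)
      (Finset.sum_nonneg fun i (_ : i ∈ Finset.univ) => hM a i)
    linarith
  linarith

theorem shannonEntropy_prod_le {J K : Type*} [Fintype J] [Fintype K] (P : J → K → ℝ)
    (hP : ∀ j k, 0 ≤ P j k) (h1 : ∑ j, ∑ k, P j k = 1) :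
    shannonEntropy (fun jk : J × K => P jk.1 jk.2) ≤
      shannonEntropy (fun j => ∑ k, P j k) + shannonEntropy (fun k => ∑ j, P j k) := by
  have hJ (j : J) (k : K) : P j k ≤ ∑ k', P j k' :=
    Finset.single_le_sum (fun k' _ => hP j k') (Finset.mem_univ k)
  have hK (j : J) (k : K) : P j k ≤ ∑ j', P j' k :=
    Finset.single_le_sum (f := fun j' => P j' k) (fun j' _ => hP j' k) (Finset.mem_univ j)
  have key (j : J) (k : K) := mul_logb_sub_logb_le (hP j k)
    (x := (∑ k', P j k') * ∑ j', P j' k) (y := P j k)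
    (fun h => mul_pos (h.trans_le (hJ j k)) (h.trans_le (hK j k))) id
  have hsum := Finset.sum_le_sum fun j (_ : j ∈ Finset.univ) =>
    Finset.sum_le_sum fun k (_ : k ∈ Finset.univ) => key j k
  have hL : ∑ j, ∑ k, P j k *
      (Real.logb 2 ((∑ k', P j k') * ∑ j', P j' k) - Real.logb 2 (P j k)) =
      shannonEntropy (fun jk : J × K => P jk.1 jk.2) -
        (shannonEntropy (fun j => ∑ k, P j k) + shannonEntropy (fun k => ∑ j, P j k)) := by
    have hlog (j : J) (k : K) : P j k * Real.logb 2 ((∑ k', P j k') * ∑ j', P j' k) =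
        P j k * Real.logb 2 (∑ k', P j k') + P j k * Real.logb 2 (∑ j', P j' k) := by
      rcases (hP j k).eq_or_lt with h | h
      · simp [← h]
      · rw [Real.logb_mul (h.trans_le (hJ j k)).ne' (h.trans_le (hK j k)).ne', mul_add]
    simp only [mul_sub, hlog, Finset.sum_sub_distrib, Finset.sum_add_distrib]
    simp only [shannonEntropy, negMulLogb, Finset.sum_neg_distrib, Finset.sum_mul, Fintype.sum_prod_type]
    rw [Finset.sum_comm (f := fun j k => P j k * Real.logb 2 (∑ j', P j' k))]
    ring
  have hR : ∑ j, ∑ k, P j k * ((∑ k', P j k') * (∑ j', P j' k) / P j k - 1) / Real.log 2 ≤ 0 := by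
    simp only [← Finset.sum_div]
    refine div_nonpos_of_nonpos_of_nonneg ?_ (Real.log_nonneg one_le_two)
    have hle (j : J) (k : K) : P j k * ((∑ k', P j k') * (∑ j', P j' k) / P j k - 1) ≤
        (∑ k', P j k') * (∑ j', P j' k) - P j k := by
      rcases (hP j k).eq_or_lt with h | h
      · rw [← h]
        simpa using mul_nonneg ((hP j k).trans (hJ j k)) ((hP j k).trans (hK j k))
      · rw [mul_sub, mul_div_cancel₀ _ h.ne', mul_one]
    refine (Finset.sum_le_sum fun j _ => Finset.sum_le_sum fun k _ => hle j k).trans ?_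
    simp only [Finset.sum_sub_distrib, ← Finset.mul_sum, ← Finset.sum_mul]
    rw [Finset.sum_comm (f := fun k j => P j k), h1]
    norm_num
  linarith

end ShannonInequalities

section CanonicalTrace

variable {α : Type*} [Fintype α] [DecidableEq α] {X Y : StarSubalgebra ℂ (Matrix α α ℂ)}

namespace IsCanonicalTrace

variable {τ : Matrix α α ℂ →ₗ[ℂ] ℂ}

theorem trace_mul_projn (hτ : IsCanonicalTrace X τ) {q : Matrix α α ℂ} (hqX : q ∈ X)
    (hq : q * q = q) {z : Matrix α α ℂ} (hz : z ∈ X) : τ (q * z * q) = τ (q * z) := by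
  rw [hτ.1 _ (mul_mem hqX hz) _ hqX, ← mul_assoc, hq]

theorem compress_eq (hτ : IsCanonicalTrace X τ) {q : Matrix α α ℂ} (hq : IsMinProjOf X q)
    {z : Matrix α α ℂ} (hz : z ∈ X) : q * z * q = τ (q * z) • q := by
  obtain ⟨c, hc⟩ := hq.exists_smul hz
  rw [← hτ.trace_mul_projn hq.1 hq.2.1.2 hz, hc, map_smul, hτ.2.2 q hq, smul_eq_mul, mul_one]

theorem nonneg_projn_mul (hτ : IsCanonicalTrace X τ) {q : Matrix α α ℂ} (hqX : q ∈ X)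
    (hq : IsProjn q) {b : Matrix α α ℂ} (hb : b ∈ X) : 0 ≤ τ (q * (star b * b)) := by
  have h := hτ.2.1 (b * q) (mul_mem hb hqX)
  have hs : star q = q := hq.1
  rwa [star_mul, hs, show q * star b * (b * q) = q * (star b * b) * q by simp only [mul_assoc],
    hτ.trace_mul_projn hqX hq.2 (mul_mem (star_mem hb) hb)] at h

end IsCanonicalTrace

theorem IsAlgEntropy.exists_spectral {ρ : Matrix α α ℂ} {H : ℝ} (hρ : MatState ρ)
    (hH : IsAlgEntropy X ρ H) :
    ∃ τ r, IsCanonicalTrace X τ ∧ IsRestriction X τ ρ r ∧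
      ∃ (m : ℕ) (p : Fin m → Matrix α α ℂ) (l : Fin m → ℝ),
        (∀ i, IsMinProjOf X (p i)) ∧ ∑ i, p i = 1 ∧ (∀ i, r * p i = (l i : ℂ) • p i) ∧
        (∀ i, (ρ * p i).trace = l i) ∧ ∑ i, l i = 1 ∧ H = shannonEntropy l := by
  obtain ⟨τ, r, hτ, hr, rfl⟩ := hH
  obtain ⟨m, p, l, hp, hsum, hl⟩ := exists_isMinProjOf_decomposition hr.1 hr.2.1.1
  have htr (i : Fin m) : (ρ * p i).trace = l i := by
    rw [← hr.2.2 _ (hp i).1, hl, map_smul, hτ.2.2 _ (hp i), smul_eq_mul, mul_one]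
  refine ⟨τ, r, hτ, hr, m, p, l, hp, hsum, hl, htr, ?_, ?_⟩
  · have : (∑ i, (l i : ℂ)) = 1 := by
      simp only [← htr]
      rw [← trace_sum, ← Finset.mul_sum, hsum, mul_one, hρ.2]
    exact_mod_cast this
  · have hdec : r * matLogb r = ∑ i, ((l i * Real.logb 2 (l i) : ℝ) : ℂ) • p i := by
      rw [← mul_one (r * matLogb r), ← hsum, Finset.mul_sum]
      refine Finset.sum_congr rfl fun i _ => ?_
      rw [matLogb_eq_cfc hr.2.1.1, mul_assoc, cfc_mul_of_mul_eq_smul hr.2.1.1 _ (hl i),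
        mul_smul_comm, hl, smul_smul, mul_comm, Complex.ofReal_mul]
    rw [algEntropy, hdec, map_sum, Complex.re_sum, shannonEntropy, ← Finset.sum_neg_distrib]
    refine Finset.sum_congr rfl fun i _ => ?_
    rw [map_smul, hτ.2.2 _ (hp i), smul_eq_mul, mul_one, Complex.ofReal_re, negMulLogb]

end CanonicalTrace

section Compatible

variable {α : Type*} [Fintype α] [DecidableEq α] {X Y : StarSubalgebra ℂ (Matrix α α ℂ)}

namespace CompatibleAlg

theorem exists_compress_eq (hXY : CompatibleAlg X Y) {s : Matrix α α ℂ} (hs : IsMinProjOf Y s)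
    {z : Matrix α α ℂ} (hz : z ∈ X ⊔ Y) : ∃ x ∈ X, s * z * s = x * s := by
  let T : Set (Matrix α α ℂ) := {t | ∀ y ∈ Y, ∃ x ∈ X, s * y * t * s = x * s}
  have hadd {t t' : Matrix α α ℂ} (ht : t ∈ T) (ht' : t' ∈ T) : t + t' ∈ T := by
    intro y hy
    obtain ⟨x, hx, h⟩ := ht y hy
    obtain ⟨x', hx', h'⟩ := ht' y hy
    exact ⟨x + x', add_mem hx hx', by rw [mul_add, add_mul, add_mul, h, h']⟩
  have hone : (1 : Matrix α α ℂ) ∈ T := by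
    intro y hy
    obtain ⟨c, hc⟩ := hs.exists_smul hy
    exact ⟨algebraMap ℂ _ c, algebraMap_mem X c, by rw [mul_one, hc, Algebra.smul_def]⟩
  have hX {x t : Matrix α α ℂ} (hx : x ∈ X) (ht : t ∈ T) : x * t ∈ T := by
    intro y hy
    obtain ⟨x', hx', h⟩ := ht y hy
    refine ⟨x * x', mul_mem hx hx', ?_⟩
    rw [← mul_assoc, ← hXY x hx _ (mul_mem hs.1 hy), mul_assoc x, mul_assoc x, mul_assoc x]
    simp only [mul_assoc] at h ⊢
    rw [h]
  have hY {y t : Matrix α α ℂ} (hy : y ∈ Y) (ht : t ∈ T) : y * t ∈ T := by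
    intro y' hy'
    obtain ⟨x, hx, h⟩ := ht (y' * y) (mul_mem hy' hy)
    exact ⟨x, hx, by rw [← h]; simp only [mul_assoc]⟩
  have hZ : ∀ t ∈ T, z * t ∈ T := by
    have hz' : z ∈ Algebra.adjoin ℂ (((X : Set (Matrix α α ℂ)) ∪ Y) ∪ star (↑X ∪ ↑Y)) := hz
    clear hz
    induction hz' using Algebra.adjoin_induction with
    | mem w hw =>
      intro t ht
      rcases hw with (hw | hw) | (hw | hw)
      · exact hX hw ht
      · exact hY hw ht
      · exact hX (star_mem_iff.1 hw) ht
      · exact hY (star_mem_iff.1 hw) ht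
    | algebraMap c => exact fun t ht => hX (algebraMap_mem X c) ht
    | add a b _ _ ha hb =>
      intro t ht
      rw [add_mul]
      exact hadd (ha t ht) (hb t ht)
    | mul a b _ _ ha hb =>
      intro t ht
      rw [mul_assoc]
      exact ha _ (hb t ht)
  obtain ⟨x, hx, h⟩ := hZ 1 hone 1 (one_mem Y)
  exact ⟨x, hx, by simpa using h⟩

theorem exists_eq_mul_of_isMinProjOf_sup (hXY : CompatibleAlg X Y) {s u : Matrix α α ℂ}
    (hs : IsMinProjOf Y s) (hu : IsMinProjOf (X ⊔ Y) u) (hsu : s * u * s = u) :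
    ∃ p, IsMinProjOf X p ∧ u = p * s := by
  obtain ⟨x', hx', hux'⟩ := hXY.exists_compress_eq hs hu.1
  rw [hsu] at hux'
  obtain ⟨x, hxX, hx, hux⟩ : ∃ x ∈ X, x.IsHermitian ∧ u = x * s := by
    refine ⟨(1 / 2 : ℂ) • (x' + star x'), X.smul_mem (add_mem hx' (star_mem hx')) _, ?_, ?_⟩
    · simp [IsHermitian, star_eq_conjTranspose, add_comm]
    · have hstar : u = star x' * s := by
        have := congrArg star hux'
        rw [star_mul, show star u = u from hu.2.1.1, show star s = s from hs.2.1.1] at this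
        rw [this, hXY _ (star_mem hx') _ hs.1]
      rw [smul_mul_assoc, add_mul, ← hux', ← hstar]
      module
  obtain ⟨m, p, a, hp, hsum, ha⟩ := exists_isMinProjOf_decomposition hxX hx
  obtain ⟨i, hi⟩ : ∃ i, u * p i ≠ 0 := by
    by_contra! hcon
    apply hu.2.2.1
    rw [← mul_one u, ← hsum, Finset.mul_sum]
    exact Finset.sum_eq_zero fun i _ => hcon i
  have hpx : p i * x = (a i : ℂ) • p i := by
    have := congrArg conjTranspose (ha i)
    simpa [conjTranspose_mul, hx.eq, (hp i).2.1.1.eq] using this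
  have hps : p i * s = s * p i := hXY _ (hp i).1 _ hs.1
  have hup : u * p i = (a i : ℂ) • (p i * s) := by
    rw [hux, mul_assoc, ← hps, ← mul_assoc, ha, smul_mul_assoc]
  have hpu : p i * u = (a i : ℂ) • (p i * s) := by
    rw [hux, ← mul_assoc, hpx, smul_mul_assoc]
  have hproj : IsProjn (u * p i) := hu.2.1.mul_of_commute (hp i).2.1 (by rw [hup, hpu])
  have hupu : u * p i * u = u * p i := by
    rw [mul_assoc, hpu, ← hup, ← mul_assoc, hu.2.1.2]
  have huu : u * p i = u :=
    (hu.2.2.2 _ (mul_mem hu.1 (StarSubalgebra.mem_sup_left (hp i).1)) hproj hupu).resolve_left hi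
  have hu' : u = (a i : ℂ) • (p i * s) := by rw [← hup, huu]
  have hps2 : p i * s * (p i * s) = p i * s :=
    ((hp i).2.1.mul_of_commute hs.2.1 hps).2
  have h1 : (a i : ℂ) • u = u := by
    conv_rhs => rw [← hu.2.1.2, hu']
    rw [smul_mul_assoc, mul_smul_comm, hps2, ← hu']
  have ha1 : (a i : ℂ) = 1 := by
    have : ((a i : ℂ) - 1) • u = 0 := by rw [sub_smul, h1, one_smul, sub_self]
    exact sub_eq_zero.1 ((smul_eq_zero.1 this).resolve_right hu.2.2.1)
  exact ⟨p i, hp i, by rw [hu', ha1, one_smul]⟩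

theorem exists_compress_eq_smul (hXY : CompatibleAlg X Y) {τ : Matrix α α ℂ →ₗ[ℂ] ℂ}
    (hτ : IsCanonicalTrace (X ⊔ Y) τ) {s q : Matrix α α ℂ} (hs : IsMinProjOf Y s)
    (hq : IsMinProjOf (X ⊔ Y) q) (h0 : s * q * s ≠ 0) :
    ∃ p, IsMinProjOf X p ∧ s * q * s = τ (q * s) • (p * s) := by
  have hsZ : s ∈ X ⊔ Y := StarSubalgebra.mem_sup_right hs.1
  have htZ : s * q * s ∈ X ⊔ Y := mul_mem (mul_mem hsZ hq.1) hsZ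
  set w := τ (q * s) with hw
  have hss : star s = s := hs.2.1.1
  have hwnn : 0 ≤ w := by
    have := hτ.nonneg_projn_mul hq.1 hq.2.1 hsZ
    rwa [hss, hs.2.1.2] at this
  have hcomp (z : Matrix α α ℂ) (hz : z ∈ X ⊔ Y) : (s * q * s) * z * (s * q * s) =
      τ (q * (s * z * s)) • (s * q * s) := by
    calc _ = s * (q * (s * z * s) * q) * s := by simp only [mul_assoc]
      _ = _ := by
        rw [hτ.compress_eq hq (mul_mem (mul_mem hsZ hz) hsZ), mul_smul_comm, smul_mul_assoc]
  have htt : (s * q * s) * (s * q * s) = w • (s * q * s) := by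
    have := hcomp 1 (one_mem _)
    rwa [mul_one, mul_one, hs.2.1.2] at this
  have hwstar : star w = w := IsSelfAdjoint.of_nonneg hwnn
  have htH : (s * q * s).IsHermitian := by
    simp only [IsHermitian, conjTranspose_mul, hs.2.1.1.eq, hq.2.1.1.eq, mul_assoc]
  have hw0 : w ≠ 0 := by
    intro hw0
    rw [hw0, zero_smul] at htt
    exact h0 (conjTranspose_mul_self_eq_zero.1 (by rwa [htH.eq]))
  have hu' : IsProjn (w⁻¹ • (s * q * s)) := by
    constructor
    · rw [IsHermitian, conjTranspose_smul, htH.eq, star_inv₀, hwstar]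
    · rw [smul_mul_assoc, mul_smul_comm, htt, smul_smul w⁻¹ w, inv_mul_cancel₀ hw0, one_smul]
  have hu : IsMinProjOf (X ⊔ Y) (w⁻¹ • (s * q * s)) := by
    refine ⟨(X ⊔ Y).smul_mem htZ _, hu', smul_ne_zero (inv_ne_zero hw0) h0, ?_⟩
    · intro e heZ he heu
      have hue := he.mul_eq_of_mul_eq hu' heu
      obtain ⟨c, hc⟩ : ∃ c : ℂ, e = c • (w⁻¹ • (s * q * s)) := by
        refine ⟨w⁻¹ * τ (q * (s * e * s)), ?_⟩
        calc e = w⁻¹ • (s * q * s) * e * (w⁻¹ • (s * q * s)) := by rw [hue, heu]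
          _ = _ := by
            rw [smul_mul_assoc, smul_mul_assoc, mul_smul_comm, hcomp e heZ]
            module
      have hcc : (c * c - c) • (w⁻¹ • (s * q * s)) = 0 := by
        have := he.2
        rw [hc, smul_mul_assoc, mul_smul_comm, hu'.2, smul_smul] at this
        rw [sub_smul, this, sub_self]
      have hc01 : c * (c - 1) = 0 := by
        have := (smul_eq_zero.1 hcc).resolve_right (smul_ne_zero (inv_ne_zero hw0) h0)
        linear_combination this
      rcases mul_eq_zero.1 hc01 with h | h
      · exact Or.inl (by rw [hc, h, zero_smul])
      · exact Or.inr (by rw [hc, sub_eq_zero.1 h, one_smul])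
  obtain ⟨p, hp, hup⟩ := hXY.exists_eq_mul_of_isMinProjOf_sup hs hu (by
    rw [mul_smul_comm, smul_mul_assoc, show s * (s * q * s) * s = (s * s) * q * (s * s) by
      simp only [mul_assoc], hs.2.1.2])
  exact ⟨p, hp, by rw [← hup, smul_smul, mul_inv_cancel₀ hw0, one_smul]⟩

theorem mul_trace_le_one (hXY : CompatibleAlg X Y) {τ τX : Matrix α α ℂ →ₗ[ℂ] ℂ}
    (hτ : IsCanonicalTrace (X ⊔ Y) τ) (hτX : IsCanonicalTrace X τX)
    {s q r g : Matrix α α ℂ} (hs : IsMinProjOf Y s) (hq : IsMinProjOf (X ⊔ Y) q)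
    (hr : r ∈ X) (hgX : g ∈ X) (hg : g.IsHermitian) (hgr : g * r * g = g) {μ : ℝ} (hμ : 0 ≤ μ)
    (hdom : ∀ x ∈ X, (μ : ℂ) * τ (q * (s * (star x * x))) ≤ τX (r * (star x * x))) :
    (μ : ℂ) * τ (q * (s * g)) ≤ 1 := by
  have hsZ : s ∈ X ⊔ Y := StarSubalgebra.mem_sup_right hs.1
  have hss : star s = s := hs.2.1.1
  have hgg : star g = g := hg
  have hinX {x : Matrix α α ℂ} (hx : x ∈ X) : x ∈ X ⊔ Y := StarSubalgebra.mem_sup_left hx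
  by_cases h0 : s * q * s = 0
  · have hqs : q * s = 0 := by
      refine conjTranspose_mul_self_eq_zero.1 ?_
      rw [conjTranspose_mul, hs.2.1.1.eq, hq.2.1.1.eq, ← mul_assoc, mul_assoc s, hq.2.1.2, h0]
    rw [← mul_assoc, hqs, zero_mul, map_zero, mul_zero]
    exact zero_le_one
  obtain ⟨p, hp, ht⟩ := hXY.exists_compress_eq_smul hτ hs hq h0
  set w := τ (q * s) with hw
  have hw0 : w ≠ 0 := fun h => h0 (by rw [ht, h, zero_smul])
  have hwnn : 0 ≤ w := by
    have := hτ.nonneg_projn_mul hq.1 hq.2.1 hsZ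
    rwa [hss, hs.2.1.2] at this
  have hps : p * s = s * p := hXY _ hp.1 _ hs.1
  have hpp : star p = p := hp.2.1.1
  have eval (x : Matrix α α ℂ) (hx : x ∈ X) (c : ℂ) (hc : p * x * p = c • p) :
      τ (q * (s * x)) = w * c := by
    have h1 : (s * q * s) * x * (s * q * s) = τ (q * (s * x)) • (s * q * s) := by
      calc _ = s * (q * (s * x * s) * q) * s := by simp only [mul_assoc]
        _ = s * (q * (s * x) * q) * s := by
          rw [mul_assoc s x s, hXY x hx s hs.1, ← mul_assoc s s, hs.2.1.2]
        _ = _ := by rw [hτ.compress_eq hq (mul_mem hsZ (hinX hx)), mul_smul_comm, smul_mul_assoc]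
    have h2 : (s * q * s) * x * (s * q * s) = (w * c) • (s * q * s) := by
      rw [ht, smul_mul_assoc, smul_mul_assoc, mul_smul_comm]
      have : p * s * x * (p * s) = c • (p * s) := by
        calc p * s * x * (p * s) = p * (s * x) * (p * s) := by simp only [mul_assoc]
          _ = p * x * (s * p) * s := by rw [← hXY x hx s hs.1]; simp only [mul_assoc]
          _ = p * x * p * (s * s) := by rw [← hps]; simp only [mul_assoc]
          _ = c • (p * s) := by rw [hc, hs.2.1.2, smul_mul_assoc]
      rw [this]
      module
    have h3 : (τ (q * (s * x)) - w * c) • (s * q * s) = 0 := by rw [sub_smul, ← h1, ← h2, sub_self]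
    exact sub_eq_zero.1 ((smul_eq_zero.1 h3).resolve_right h0)
  set γ := τX (p * g) with hγ
  have hpgp : p * g * p = γ • p := hτX.compress_eq hp hgX
  have hpg : p * g ∈ X := mul_mem hp.1 hgX
  have hsq : star (p * g) * (p * g) = g * p * g := by
    rw [star_mul, hpp, hgg, mul_assoc, ← mul_assoc p, hp.2.1.2, mul_assoc]
  have hd := hdom (p * g) hpg
  rw [hsq] at hd
  have hrγ : τX (r * (g * p * g)) = γ := by
    rw [show r * (g * p * g) = r * (g * p) * g by simp only [mul_assoc],
      hτX.1 _ (mul_mem hr (mul_mem hgX hp.1)) _ hgX,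
      show g * (r * (g * p)) = g * r * g * p by simp only [mul_assoc], hgr, hτX.1 _ hgX _ hp.1]
  have hgg2 : τ (q * (s * (g * p * g))) = w * (γ * γ) := by
    refine eval _ (mul_mem (mul_mem hgX hp.1) hgX) _ ?_
    calc p * (g * p * g) * p = p * g * (p * p) * g * p := by rw [hp.2.1.2]; simp only [mul_assoc]
      _ = (p * g * p) * (p * g * p) := by simp only [mul_assoc]
      _ = (γ * γ) • p := by rw [hpgp, smul_mul_assoc, mul_smul_comm, hp.2.1.2, smul_smul]
  rw [hrγ, hgg2] at hd
  have hg1 := eval g hgX γ hpgp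
  rw [hg1]
  have hγreal : star γ = γ := by
    have h1 := congrArg star hpgp
    rw [star_mul, star_mul, hpp, hgg, star_smul, hpp, ← mul_assoc, hpgp] at h1
    have : (star γ - γ) • p = 0 := by rw [sub_smul, ← h1, sub_self]
    exact sub_eq_zero.1 ((smul_eq_zero.1 this).resolve_right hp.2.2.1)
  obtain ⟨γ', hγ'⟩ := Complex.conj_eq_iff_real.1 hγreal
  obtain ⟨w', hw'⟩ := Complex.conj_eq_iff_real.1 (IsSelfAdjoint.of_nonneg hwnn)
  rw [hγ', hw'] at hd ⊢
  rw [hw'] at hwnn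
  norm_cast at hd hwnn ⊢
  by_contra! hlt
  have : 0 < γ' := by
    by_contra! hneg
    have := mul_nonneg hμ hwnn
    nlinarith
  nlinarith

end CompatibleAlg

end Compatible

theorem algEntropy_le_add_of_compatible {α : Type*} [Fintype α] [DecidableEq α]
    {X Y : StarSubalgebra ℂ (Matrix α α ℂ)} (hXY : CompatibleAlg X Y)
    {ρ : Matrix α α ℂ} (hρ : MatState ρ) {HX HY HXY : ℝ}
    (hHX : IsAlgEntropy X ρ HX) (hHY : IsAlgEntropy Y ρ HY)
    (hHXY : IsAlgEntropy (X ⊔ Y) ρ HXY) : HX ≤ HY + HXY := by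
  obtain ⟨τX, r, hτX, ⟨hrX, hrpos, hrρ⟩, m, p, l, hp, hpsum, hrp, hρp, -, rfl⟩ :=
    hHX.exists_spectral hρ
  obtain ⟨-, -, -, -, m', s, ν, hs, hssum, -, hρs, hνsum, rfl⟩ := hHY.exists_spectral hρ
  obtain ⟨τ, R, hτ, ⟨hRZ, -, hRρ⟩, m'', q, μ, hq, hqsum, hRq, hρq, -, rfl⟩ :=
    hHXY.exists_spectral hρ
  have hXZ {x : Matrix α α ℂ} (hx : x ∈ X) : x ∈ X ⊔ Y := StarSubalgebra.mem_sup_left hx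
  have hsZ (j : Fin m') : s j ∈ X ⊔ Y := StarSubalgebra.mem_sup_right (hs j).1
  have hexp (z : Matrix α α ℂ) (hz : z ∈ X ⊔ Y) : ∑ k, (μ k : ℂ) * τ (q k * z) = (ρ * z).trace := by
    rw [← hRρ z hz]
    conv_rhs => rw [← mul_one R, ← hqsum, Finset.mul_sum, Finset.sum_mul, map_sum]
    exact Finset.sum_congr rfl fun k _ => by rw [hRq, smul_mul_assoc, map_smul, smul_eq_mul]
  have htrq (k : Fin m'') : τ (q k) = 1 := hτ.2.2 _ (hq k)
  have hpos {b : Matrix α α ℂ} (hb : b ∈ X) (j : Fin m') (k : Fin m'') :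
      0 ≤ τ (q k * (s j * (star b * b))) := by
    have hss : star (s j) = s j := (hs j).2.1.1
    have hbs := hXY _ (mul_mem (star_mem hb) hb) _ (hs j).1
    have h := hτ.nonneg_projn_mul (hq k).1 (hq k).2.1 (mul_mem (hXZ hb) (hsZ j))
    rwa [star_mul, hss, show s j * star b * (b * s j) = s j * (star b * b * s j) by
      simp only [mul_assoc], hbs, ← mul_assoc (s j), (hs j).2.1.2] at h
  have hμ (k : Fin m'') : 0 ≤ μ k := by
    have h : 0 ≤ (ρ * (q k * q k)).trace := by
      have := (hρ.1.mul_mul_conjTranspose_same (q k)).trace_nonneg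
      rwa [(hq k).2.1.1.eq, trace_mul_comm, ← mul_assoc, trace_mul_comm] at this
    rw [(hq k).2.1.2, hρq] at h
    exact_mod_cast h
  have hdom (j : Fin m') (k : Fin m'') (x : Matrix α α ℂ) (hx : x ∈ X) :
      (μ k : ℂ) * τ (q k * (s j * (star x * x))) ≤ τX (r * (star x * x)) := by
    have hxx := mul_mem (star_mem hx) hx
    have hsplit (k : Fin m'') : τ (q k * (star x * x)) =
        ∑ j, τ (q k * (s j * (star x * x))) := by
      rw [← map_sum, ← Finset.mul_sum, ← Finset.sum_mul, hssum, one_mul]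
    rw [hrρ _ hxx, ← hexp _ (hXZ hxx)]
    simp only [hsplit, Finset.mul_sum]
    have hμ' (k : Fin m'') : (0 : ℂ) ≤ μ k := by exact_mod_cast hμ k
    have hterm (k : Fin m'') (j : Fin m') : 0 ≤ (μ k : ℂ) * τ (q k * (s j * (star x * x))) :=
      mul_nonneg (hμ' k) (hpos hx j k)
    refine (Finset.single_le_sum (f := fun j => (μ k : ℂ) * τ (q k * (s j * (star x * x))))
      (fun j _ => hterm k j) (Finset.mem_univ j)).trans ?_
    exact Finset.single_le_sum
      (f := fun k => ∑ j, (μ k : ℂ) * τ (q k * (s j * (star x * x))))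
      (fun k _ => Finset.sum_nonneg fun j _ => hterm k j) (Finset.mem_univ k)
  let M (a : Fin m' × Fin m'') (i : Fin m) : ℝ := (μ a.2 * (τ (q a.2 * (s a.1 * p i))).re)
  let P (j : Fin m') (k : Fin m'') : ℝ := μ k * (τ (q k * s j)).re
  have hM (a : Fin m' × Fin m'') (i : Fin m) : 0 ≤ M a i := by
    have h := hpos (hp i).1 a.1 a.2
    rw [show star (p i) = p i from (hp i).2.1.1, (hp i).2.1.2] at h
    exact mul_nonneg (hμ _) (Complex.le_def.1 h).1
  have hMrow (a : Fin m' × Fin m'') : ∑ i, M a i = P a.1 a.2 := by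
    simp only [M, P]
    rw [← Finset.mul_sum, ← Complex.re_sum, ← map_sum, ← Finset.mul_sum, ← Finset.mul_sum, hpsum,
      mul_one]
  have hre (z : Matrix α α ℂ) (hz : z ∈ X ⊔ Y) :
      ∑ k, μ k * (τ (q k * z)).re = (ρ * z).trace.re := by
    rw [← hexp z hz, Complex.re_sum]
    exact Finset.sum_congr rfl fun k _ => (Complex.re_ofReal_mul _ _).symm
  have hMcol (i : Fin m) : ∑ a, M a i = l i := by
    simp only [M]
    rw [Fintype.sum_prod_type_right]
    simp only
    simp only [← Finset.mul_sum, ← Complex.re_sum, ← map_sum, ← Finset.sum_mul, hssum, one_mul]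
    rw [hre _ (hXZ (hp i).1), hρp, Complex.ofReal_re]
  have hPk (j : Fin m') : ∑ k, P j k = ν j := by
    simp only [P]
    rw [hre _ (hsZ j), hρs, Complex.ofReal_re]
  have hPj (k : Fin m'') : ∑ j, P j k = μ k := by
    simp only [P]
    rw [← Finset.mul_sum, ← Complex.re_sum, ← map_sum, ← Finset.mul_sum, hssum, mul_one, htrq,
      Complex.one_re, mul_one]
  have hPnn (j : Fin m') (k : Fin m'') : 0 ≤ P j k := by
    rw [← hMrow (j, k)]
    exact Finset.sum_nonneg fun i _ => hM _ i
  have hbound (a : Fin m' × Fin m'') : ∑ i, M a i / ∑ a', M a' i ≤ 1 := by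
    set g := hrpos.1.cfc (·⁻¹) with hgdef
    have hgp (i : Fin m) : g * p i = ((l i)⁻¹ : ℂ) • p i := by
      rw [hgdef, cfc_mul_of_mul_eq_smul hrpos.1 _ (hrp i), Complex.ofReal_inv]
    have hgsum : g = ∑ i, ((l i)⁻¹ : ℂ) • p i := by
      rw [← mul_one g, ← hpsum, Finset.mul_sum]
      exact Finset.sum_congr rfl fun i _ => hgp i
    have hgX : g ∈ X := by
      rw [hgsum]
      exact sum_mem fun i _ => X.smul_mem (hp i).1 _
    have hgH : g.IsHermitian := by
      rw [hgsum, IsHermitian, conjTranspose_sum]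
      refine Finset.sum_congr rfl fun i _ => ?_
      rw [conjTranspose_smul, (hp i).2.1.1.eq]
      simp
    have hgrg : g * r * g = g := by
      conv_lhs => rw [← mul_one (g * r * g), ← hpsum, Finset.mul_sum]
      rw [hgsum]
      refine Finset.sum_congr rfl fun i _ => ?_
      rw [← hgsum, mul_assoc, hgp, mul_smul_comm, mul_assoc, hrp, mul_smul_comm, hgp, smul_smul,
        smul_smul]
      congr 1
      by_cases h : (l i : ℂ) = 0
      · simp [h]
      · field_simp
    have h := hXY.mul_trace_le_one hτ hτX (hs a.1) (hq a.2) hrX hgX hgH hgrg (hμ a.2)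
      (hdom a.1 a.2)
    have hre1 := (Complex.le_def.1 h).1
    rw [Complex.re_ofReal_mul, Complex.one_re] at hre1
    refine le_of_eq_of_le ?_ hre1
    rw [hgsum, Finset.mul_sum, Finset.mul_sum, map_sum, Complex.re_sum, Finset.mul_sum]
    refine Finset.sum_congr rfl fun i _ => ?_
    rw [hMcol, mul_smul_comm, mul_smul_comm, map_smul, smul_eq_mul, ← Complex.ofReal_inv,
      Complex.re_ofReal_mul]
    simp only [M]
    ring
  have h1 := shannonEntropy_colSum_le_rowSum M hM hbound
  have h2 := shannonEntropy_prod_le P hPnn (by simpa only [hPk] using hνsum)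
  simp only [hMcol, hMrow] at h1
  simp only [hPk, hPj] at h2
  exact h1.trans h2

/-- `I_ρ(𝔛∧𝔜) ≤ 2·min{H_ρ(𝔛), H_ρ(𝔜)}` for compatible unital
*-subalgebras. -/
theorem mutual_information_le_two_min {n : ℕ}
    (ρ : Matrix (Fin n) (Fin n) ℂ) (hρ : MatState ρ)
    (𝔛 𝔜 : StarSubalgebra ℂ (Matrix (Fin n) (Fin n) ℂ))
    (hcomp : CompatibleAlg 𝔛 𝔜)
    (HX HY HXY : ℝ)
    (hHX : IsAlgEntropy 𝔛 ρ HX) (hHY : IsAlgEntropy 𝔜 ρ HY)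
    (hHXY : IsAlgEntropy (𝔛 ⊔ 𝔜) ρ HXY) :
    HX + HY - HXY ≤ 2 * min HX HY := by
  have h1 := algEntropy_le_add_of_compatible hcomp hρ hHX hHY hHXY
  have h2 := algEntropy_le_add_of_compatible (fun y hy x hx => (hcomp x hx y hy).symm) hρ hHY hHX
    (sup_comm 𝔛 𝔜 ▸ hHXY)
  rcases min_cases HX HY with h | h <;> linarith
end
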